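/- arXiv:1103.0341 — 3 statements merged into one kernel-verified Lean document; each statement's English description precedes it below -/
import Mathlib

section
/- Let f : ℝ → ℝ be 6 times continuously differentiable. Then for all a, b ∈ ℝ, writing x = (a+b)/2, one has |(f(a) + f(b))/2 − f(x) − (1/8) f''(x)(b−a)² − (1/384) f⁽⁴⁾(x)(b−a)⁴| ≤ M(a,b) |b−a|⁶, where M(a,b) = sup_{y ∈ [a∧b, a∨b]} |f⁽⁶⁾(y)|. -/
open Set

noncomputable section

/-- Fifth-order Taylor expansion with Lagrange remainder for a `C⁶` function on `ℝ`. -/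
theorem exists_taylor_lagrange_six {f : ℝ → ℝ} (hf : ContDiff ℝ 6 f) (x h : ℝ) :
    ∃ y ∈ uIcc x (x + h), f (x + h) = f x + iteratedDeriv 1 f x * h
      + iteratedDeriv 2 f x / 2 * h ^ 2 + iteratedDeriv 3 f x / 6 * h ^ 3
      + iteratedDeriv 4 f x / 24 * h ^ 4 + iteratedDeriv 5 f x / 120 * h ^ 5
      + iteratedDeriv 6 f y / 720 * h ^ 6 := by
  rcases eq_or_ne h 0 with rfl | hh
  · exact ⟨x, left_mem_uIcc, by simp⟩
  have hne : x ≠ x + h := by simpa using hh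
  have hu : UniqueDiffOn ℝ (uIcc x (x + h)) := uniqueDiffOn_uIcc hne
  have hw : ∀ k ≤ 6,
      iteratedDerivWithin k f (uIcc x (x + h)) x = iteratedDeriv k f x := fun k hk ↦
    iteratedDerivWithin_eq_iteratedDeriv hu
      (hf.contDiffAt.of_le (by exact_mod_cast hk)) left_mem_uIcc
  obtain ⟨y, hy, e⟩ := taylor_mean_remainder_lagrange_iteratedDeriv (n := 5) hne
    (hf.of_le (by norm_num)).contDiffOn
  refine ⟨y, uIoo_subset_uIcc_self hy, ?_⟩
  rw [taylor_within_apply] at e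
  simp only [Finset.sum_range_succ, Finset.sum_range_zero] at e
  rw [hw 0 (by norm_num), hw 1 (by norm_num),
    hw 2 (by norm_num), hw 3 (by norm_num),
    hw 4 (by norm_num), hw 5 (by norm_num)] at e
  simp only [iteratedDeriv_zero, add_sub_cancel_left, smul_eq_mul, Nat.factorial] at e
  norm_num at e
  rw [iteratedDeriv_one]
  linarith

/-- A continuous function on a compact set is bounded in absolute value by the iterated supremum
over that set. -/
theorem abs_le_biSup_of_isCompact {X : Type*} [TopologicalSpace X] {g : X → ℝ} {s : Set X}
    (hs : IsCompact s) (hg : ContinuousOn g s) {y : X} (hy : y ∈ s) :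
    |g y| ≤ ⨆ z ∈ s, |g z| := by
  obtain ⟨C, hC⟩ := hs.exists_bound_of_continuousOn hg
  have hb : BddAbove (range fun z ↦ ⨆ _ : z ∈ s, |g z|) := by
    refine ⟨max C 0, ?_⟩
    rintro _ ⟨z, rfl⟩
    exact Real.iSup_le (fun hz ↦ (hC z hz).trans (le_max_left _ _)) (le_max_right _ _)
  exact le_ciSup_of_le hb y (by simp [hy])

/-- Sixth-order Taylor-type expansion of the symmetric average `(f(a)+f(b))/2` about the
midpoint `x = (a+b)/2`:
`|(f(a)+f(b))/2 - f(x) - (1/8) f''(x)(b-a)² - (1/384) f⁽⁴⁾(x)(b-a)⁴| ≤ M(a,b)|b-a|⁶`,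
where `M(a,b) = sup_{y ∈ [a⊓b, a⊔b]} |f⁽⁶⁾(y)|`. -/
theorem stmt2 (f : ℝ → ℝ) (hf : ContDiff ℝ 6 f) (a b : ℝ) :
    |(f a + f b) / 2 - f ((a + b) / 2)
        - (1 / 8) * iteratedDeriv 2 f ((a + b) / 2) * (b - a) ^ 2
        - (1 / 384) * iteratedDeriv 4 f ((a + b) / 2) * (b - a) ^ 4|
      ≤ (⨆ y ∈ Set.Icc (min a b) (max a b), |iteratedDeriv 6 f y|) * |b - a| ^ 6 := by
  obtain ⟨y, hy, ey⟩ := exists_taylor_lagrange_six hf ((a + b) / 2) ((a - b) / 2)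
  obtain ⟨z, hz, ez⟩ := exists_taylor_lagrange_six hf ((a + b) / 2) ((b - a) / 2)
  rw [show (a + b) / 2 + (a - b) / 2 = a by ring] at hy ey
  rw [show (a + b) / 2 + (b - a) / 2 = b by ring] at hz ez
  have hx : (a + b) / 2 ∈ uIcc a b := by
    rw [mem_uIcc]
    rcases le_total a b with h | h
    · left; constructor <;> linarith
    · right; constructor <;> linarith
  have hM : ∀ w ∈ uIcc a b,
      |iteratedDeriv 6 f w| ≤ ⨆ y ∈ Icc (min a b) (max a b), |iteratedDeriv 6 f y| := fun w hw ↦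
    abs_le_biSup_of_isCompact isCompact_Icc
      (hf.continuous_iteratedDeriv 6 (by norm_cast)).continuousOn hw
  have hMy := hM y (uIcc_subset_uIcc hx left_mem_uIcc hy)
  have hMz := hM z (uIcc_subset_uIcc hx right_mem_uIcc hz)
  generalize (⨆ y ∈ Icc (min a b) (max a b), |iteratedDeriv 6 f y|) = M at hMy hMz ⊢
  have key : (f a + f b) / 2 - f ((a + b) / 2)
        - (1 / 8) * iteratedDeriv 2 f ((a + b) / 2) * (b - a) ^ 2
        - (1 / 384) * iteratedDeriv 4 f ((a + b) / 2) * (b - a) ^ 4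
      = (iteratedDeriv 6 f y + iteratedDeriv 6 f z) / 92160 * (b - a) ^ 6 := by
    rw [ey, ez]; ring
  rw [key, abs_mul, abs_pow]
  gcongr
  rw [abs_le] at *
  constructor <;> linarith
end
end

section
/- The family (|r+1|^{1/3} + |r−1|^{1/3} − 2|r|^{1/3})³, indexed by r ∈ ℤ, is absolutely summable, and its sum ∑_{r∈ℤ} (|r+1|^{1/3} + |r−1|^{1/3} − 2|r|^{1/3})³ is strictly positive. Consequently the constant κ > 0 defined by κ² = (3/4) ∑_{r∈ℤ} (|r+1|^{1/3} + |r−1|^{1/3} − 2|r|^{1/3})³ is well-defined. -/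
noncomputable section

/-- The term of the series defining `κ²`:
`ρ(r) = (|r+1|^{1/3} + |r-1|^{1/3} - 2|r|^{1/3})³`. -/
def kappaTerm (r : ℤ) : ℝ :=
  (|(r : ℝ) + 1| ^ ((1 : ℝ) / 3) + |(r : ℝ) - 1| ^ ((1 : ℝ) / 3)
    - 2 * |(r : ℝ)| ^ ((1 : ℝ) / 3)) ^ 3

/-- The negated second difference of the cube root at `n + 1`. -/
def cbrtDefect (n : ℕ) : ℝ :=
  2 * ((n : ℝ) + 1) ^ ((1 : ℝ) / 3) - (n : ℝ) ^ ((1 : ℝ) / 3) - ((n : ℝ) + 2) ^ ((1 : ℝ) / 3)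

lemma cbrtDefect_nonneg (n : ℕ) : 0 ≤ cbrtDefect n := by
  have h₀ : (n : ℝ) ∈ Set.Ici 0 := Set.mem_Ici.2 n.cast_nonneg
  have h₂ : (n : ℝ) + 2 ∈ Set.Ici 0 := by rw [Set.mem_Ici]; positivity
  have hc : ConcaveOn ℝ (Set.Ici 0) fun x : ℝ => x ^ ((1 : ℝ) / 3) :=
    Real.concaveOn_rpow (by norm_num) (by norm_num)
  have h := hc.2 h₀ h₂ (by norm_num : (0 : ℝ) ≤ 1 / 2) (by norm_num : (0 : ℝ) ≤ 1 / 2)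
    (by norm_num)
  have e : (1 / 2 : ℝ) * n + 1 / 2 * ((n : ℝ) + 2) = n + 1 := by ring
  simp only [smul_eq_mul, e] at h
  unfold cbrtDefect
  linarith

lemma sum_range_cbrtDefect (N : ℕ) :
    ∑ n ∈ Finset.range N, cbrtDefect n =
      1 - (((N : ℝ) + 1) ^ ((1 : ℝ) / 3) - (N : ℝ) ^ ((1 : ℝ) / 3)) := by
  induction N with
  | zero => simp
  | succ N ih =>
    rw [Finset.sum_range_succ, ih, cbrtDefect]
    push_cast
    rw [show (N : ℝ) + 1 + 1 = N + 2 by ring]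
    ring

lemma sum_range_cbrtDefect_le_one (N : ℕ) : ∑ n ∈ Finset.range N, cbrtDefect n ≤ 1 := by
  have h : (N : ℝ) ^ ((1 : ℝ) / 3) ≤ ((N : ℝ) + 1) ^ ((1 : ℝ) / 3) :=
    Real.rpow_le_rpow (by positivity) (by linarith) (by norm_num)
  rw [sum_range_cbrtDefect]
  linarith

lemma cbrtDefect_le_one (n : ℕ) : cbrtDefect n ≤ 1 :=
  (Finset.single_le_sum (fun i _ => cbrtDefect_nonneg i) (Finset.self_mem_range_succ n)).trans
    (sum_range_cbrtDefect_le_one (n + 1))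

lemma sum_range_cbrtDefect_pow_three_le_one (N : ℕ) :
    ∑ n ∈ Finset.range N, cbrtDefect n ^ 3 ≤ 1 :=
  (Finset.sum_le_sum fun n _ =>
    pow_le_of_le_one (cbrtDefect_nonneg n) (cbrtDefect_le_one n) three_ne_zero).trans
    (sum_range_cbrtDefect_le_one N)

lemma summable_cbrtDefect_pow_three : Summable fun n => cbrtDefect n ^ 3 :=
  summable_of_sum_range_le (fun n => pow_nonneg (cbrtDefect_nonneg n) 3)
    sum_range_cbrtDefect_pow_three_le_one

lemma tsum_cbrtDefect_pow_three_le_one : ∑' n, cbrtDefect n ^ 3 ≤ 1 :=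
  Real.tsum_le_of_sum_range_le (fun n => pow_nonneg (cbrtDefect_nonneg n) 3)
    sum_range_cbrtDefect_pow_three_le_one

lemma kappaTerm_zero : kappaTerm 0 = 8 := by
  norm_num [kappaTerm]

lemma kappaTerm_neg (r : ℤ) : kappaTerm (-r) = kappaTerm r := by
  have h₁ : |-(r : ℝ) + 1| = |(r : ℝ) - 1| := by rw [← abs_neg]; congr 1; ring
  have h₂ : |-(r : ℝ) - 1| = |(r : ℝ) + 1| := by rw [← abs_neg]; congr 1; ring
  simp only [kappaTerm, Int.cast_neg, h₁, h₂, abs_neg]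
  ring

lemma kappaTerm_natCast_add_one (n : ℕ) : kappaTerm ((n : ℤ) + 1) = -cbrtDefect n ^ 3 := by
  have h₁ : |(n : ℝ) + 1 + 1| = n + 2 := by rw [abs_of_nonneg (by positivity)]; ring
  have h₂ : |(n : ℝ) + 1 - 1| = n := by rw [add_sub_cancel_right, abs_of_nonneg (by positivity)]
  have h₃ : |(n : ℝ) + 1| = n + 1 := abs_of_nonneg (by positivity)
  simp only [kappaTerm, cbrtDefect, Int.cast_add, Int.cast_natCast, Int.cast_one, h₁, h₂, h₃]
  ring

lemma hasSum_kappaTerm : HasSum kappaTerm (8 - 2 * ∑' n, cbrtDefect n ^ 3) := by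
  have h : HasSum (fun n : ℕ => kappaTerm ((n : ℤ) + 1)) (-∑' n, cbrtDefect n ^ 3) := by
    simpa only [kappaTerm_natCast_add_one] using summable_cbrtDefect_pow_three.hasSum.neg
  have h' : HasSum (fun n : ℕ => kappaTerm (-((n : ℤ) + 1))) (-∑' n, cbrtDefect n ^ 3) := by
    simpa only [kappaTerm_neg] using h
  convert h.of_add_one_of_neg_add_one h' using 1
  rw [kappaTerm_zero]
  ring

/-- The family `(|r+1|^{1/3} + |r-1|^{1/3} - 2|r|^{1/3})³`, `r ∈ ℤ`, is absolutely summable,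
its sum is strictly positive, and consequently there is a (unique) constant `κ > 0` with
`κ² = (3/4) ∑_{r ∈ ℤ} (|r+1|^{1/3} + |r-1|^{1/3} - 2|r|^{1/3})³`. -/
theorem stmt3 :
    Summable (fun r : ℤ => |kappaTerm r|) ∧
    0 < ∑' r : ℤ, kappaTerm r ∧
    ∃ κ : ℝ, 0 < κ ∧ κ ^ 2 = (3 / 4) * ∑' r : ℤ, kappaTerm r := by
  have hpos : 0 < ∑' r : ℤ, kappaTerm r := by
    rw [hasSum_kappaTerm.tsum_eq]
    linarith [tsum_cbrtDefect_pow_three_le_one]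
  refine ⟨hasSum_kappaTerm.summable.abs, hpos, √((3 / 4) * ∑' r : ℤ, kappaTerm r), ?_, ?_⟩
  · positivity
  · exact Real.sq_sqrt (by positivity)
end
end

section
/- Let φ : ℝ → ℝ be continuously differentiable with compact support. Then for every T > 0, sup_{0 ≤ t ≤ T} |∑_{j=1}^{⌊nt⌋} φ(β_{j,n}) (ΔB_{j,n})⁵| → 0 in probability as n → ∞. -/
open MeasureTheory ProbabilityTheory Filter Topology

noncomputable section

/-- `B` is a fractional Brownian motion with Hurst parameter `1/6`: a centered Gaussian
process with continuous sample paths and covariance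
`E[B s * B t] = (t^(1/3) + s^(1/3) - |t - s|^(1/3)) / 2` for `s, t ≥ 0`. -/
def IsFBM16 {Ω : Type*} [MeasureSpace Ω] (B : ℝ → Ω → ℝ) : Prop :=
  (∀ t : ℝ, Measurable (B t)) ∧
  (∀ ω : Ω, Continuous fun t : ℝ => B t ω) ∧
  (∀ (m : ℕ) (t : Fin m → ℝ) (c : Fin m → ℝ), (∀ i, 0 ≤ t i) →
    ∃ v : NNReal,
      Measure.map (fun ω => ∑ i, c i * B (t i) ω) (volume : Measure Ω) = gaussianReal 0 v) ∧
  (∀ s t : ℝ, 0 ≤ s → 0 ≤ t →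
    ∫ ω, B s ω * B t ω =
      (t ^ ((1 : ℝ) / 3) + s ^ ((1 : ℝ) / 3) - |t - s| ^ ((1 : ℝ) / 3)) / 2)

/-- A linear space of random variables, all of them centered Gaussian. -/
def IsGaussianSpace {Ω : Type*} [MeasurableSpace Ω] (P : Measure Ω)
    (S : Submodule ℝ (Ω → ℝ)) : Prop :=
  ∀ Z ∈ S, Measurable Z ∧ ∃ v : NNReal, P.map Z = gaussianReal 0 v

/-- The moment of order `2 * s` of the standard Gaussian law. -/
def gaussianMoment (s : ℕ) : ℝ := ∫ x, x ^ (2 * s) ∂(gaussianReal 0 1)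

theorem gaussianMoment_nonneg (s : ℕ) : 0 ≤ gaussianMoment s :=
  integral_nonneg fun x => by rw [pow_mul]; positivity

theorem gaussianMoment_one : gaussianMoment 1 = 1 := by
  have h := variance_fun_id_gaussianReal (μ := 0) (v := 1)
  rw [variance_eq_sub (by exact memLp_id_gaussianReal' 2 (by simp))] at h
  simpa [gaussianMoment] using h

theorem integral_even_pow_gaussianReal (v : NNReal) (s : ℕ) :
    ∫ x, x ^ (2 * s) ∂(gaussianReal 0 v) = (v : ℝ) ^ s * gaussianMoment s := by
  have h : gaussianReal 0 v = (gaussianReal 0 1).map (√(v : ℝ) * ·) := by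
    rw [gaussianReal_map_const_mul]
    congr 1
    · simp
    · ext; simp
  rw [h, integral_map (by fun_prop) (by fun_prop)]
  simp_rw [mul_pow]
  rw [integral_const_mul, pow_mul, Real.sq_sqrt (NNReal.coe_nonneg v)]
  rfl

theorem abs_monomial_le {m x a b c d : ℝ} (ha : |a| ≤ m) (hb : |b| ≤ m) (hc : |c| ≤ x)
    (hd : |d| ≤ x) (i j k l : ℕ) : |a ^ i * b ^ j * c ^ k * d ^ l| ≤ m ^ (i + j) * x ^ (k + l) := by
  have hm : 0 ≤ m := (abs_nonneg a).trans ha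
  have hx : 0 ≤ x := (abs_nonneg c).trans hc
  simp only [abs_mul, abs_pow, pow_add]
  rw [mul_assoc]
  gcongr

theorem pow_mul_pow_le_of_even {m x : ℝ} (hm : 0 ≤ m) (hx : 0 ≤ x) {e : ℕ} (h1 : 2 ≤ e)
    (h2 : e ≤ 10) : m ^ e * x ^ (10 - e) ≤ m ^ 10 + m ^ 2 * x ^ 8 := by
  rcases le_total m x with h | h
  · calc m ^ e * x ^ (10 - e) = m ^ 2 * (m ^ (e - 2) * x ^ (10 - e)) := by
          rw [← mul_assoc, ← pow_add]; congr 2; omega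
      _ ≤ m ^ 2 * (x ^ (e - 2) * x ^ (10 - e)) := by gcongr
      _ = m ^ 2 * x ^ 8 := by rw [← pow_add]; congr 2; omega
      _ ≤ _ := by have := pow_nonneg hm 10; linarith
  · calc m ^ e * x ^ (10 - e) ≤ m ^ e * m ^ (10 - e) := by gcongr
      _ = m ^ 10 := by rw [← pow_add]; congr 1; omega
      _ ≤ _ := by have : 0 ≤ m ^ 2 * x ^ 8 := by positivity
                  linarith

theorem abs_symmetrized_fifth_powers_le (a b c d : ℝ) :
    |((a + c) ^ 5 * (b + d) ^ 5 + (a - c) ^ 5 * (b - d) ^ 5) / 2 - c ^ 5 * d ^ 5| ≤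
      1024 * ((a ^ 10 + b ^ 10) + (a ^ 2 + b ^ 2) * (c ^ 8 + d ^ 8)) := by
  set m := max |a| |b| with hm
  set x := max |c| |d| with hx
  have hm0 : 0 ≤ m := (abs_nonneg a).trans (le_max_left _ _)
  have hx0 : 0 ≤ x := (abs_nonneg c).trans (le_max_left _ _)
  have key : ∀ i j k l : ℕ, i + j + (k + l) = 10 → 2 ≤ i + j →
      |a ^ i * b ^ j * c ^ k * d ^ l| ≤ m ^ 10 + m ^ 2 * x ^ 8 := by
    intro i j k l h h2
    refine (abs_monomial_le (le_max_left _ _) (le_max_right _ _) (le_max_left _ _)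
      (le_max_right _ _) i j k l).trans ?_
    have : k + l = 10 - (i + j) := by omega
    rw [← hm, ← hx, this]
    exact pow_mul_pow_le_of_even hm0 hx0 h2 (by omega)
  have e1 : ∀ n, Even n → m ^ n ≤ a ^ n + b ^ n := by
    intro n hn
    have h1 := hn.pow_nonneg a
    have h2 := hn.pow_nonneg b
    rcases max_choice |a| |b| with h | h <;> rw [hm, h, hn.pow_abs] <;> linarith
  have e2 : x ^ 8 ≤ c ^ 8 + d ^ 8 := by
    have hn : Even 8 := by decide
    have h1 := hn.pow_nonneg c
    have h2 := hn.pow_nonneg d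
    rcases max_choice |c| |d| with h | h <;> rw [hx, h, hn.pow_abs] <;> linarith
  have hR : m ^ 10 + m ^ 2 * x ^ 8 ≤ (a ^ 10 + b ^ 10) + (a ^ 2 + b ^ 2) * (c ^ 8 + d ^ 8) := by
    have h1 := e1 10 (by decide)
    have h2 := e1 2 (by decide)
    have : m ^ 2 * x ^ 8 ≤ (a ^ 2 + b ^ 2) * (c ^ 8 + d ^ 8) := by gcongr
    linarith
  have hR0 : 0 ≤ m ^ 10 + m ^ 2 * x ^ 8 := by positivity
  refine le_trans ?_ (mul_le_mul_of_nonneg_left hR (by norm_num : (0 : ℝ) ≤ 1024))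
  generalize m ^ 10 + m ^ 2 * x ^ 8 = R at key hR0
  have t1 := abs_le.1 (key 2 0 3 5 rfl (by norm_num))
  have t2 := abs_le.1 (key 1 1 4 4 rfl (by norm_num))
  have t3 := abs_le.1 (key 0 2 5 3 rfl (by norm_num))
  have t4 := abs_le.1 (key 4 0 1 5 rfl (by norm_num))
  have t5 := abs_le.1 (key 3 1 2 4 rfl (by norm_num))
  have t6 := abs_le.1 (key 2 2 3 3 rfl (by norm_num))
  have t7 := abs_le.1 (key 1 3 4 2 rfl (by norm_num))
  have t8 := abs_le.1 (key 0 4 5 1 rfl (by norm_num))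
  have t9 := abs_le.1 (key 5 1 0 4 rfl (by norm_num))
  have t10 := abs_le.1 (key 4 2 1 3 rfl (by norm_num))
  have t11 := abs_le.1 (key 3 3 2 2 rfl (by norm_num))
  have t12 := abs_le.1 (key 2 4 3 1 rfl (by norm_num))
  have t13 := abs_le.1 (key 1 5 4 0 rfl (by norm_num))
  have t14 := abs_le.1 (key 5 3 0 2 rfl (by norm_num))
  have t15 := abs_le.1 (key 4 4 1 1 rfl (by norm_num))
  have t16 := abs_le.1 (key 3 5 2 0 rfl (by norm_num))
  have t17 := abs_le.1 (key 5 5 0 0 rfl (by norm_num))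
  rw [abs_le]
  constructor <;> ring_nf at * <;> linarith

theorem abs_fifth_powers_sub_le {r : ℝ} (hr : |r| ≤ 1) (x y : ℝ) :
    |x ^ 5 * (r * x + y) ^ 5 - x ^ 5 * y ^ 5| ≤ 31 * |r| * (x ^ 10 + y ^ 10) := by
  set R := x ^ 10 + y ^ 10 with hR
  have hR0 : 0 ≤ R := by positivity
  have key : ∀ k, 1 ≤ k → k ≤ 5 → |r ^ k * x ^ (5 + k) * y ^ (5 - k)| ≤ |r| * R := by
    intro k hk1 hk2
    rw [mul_assoc, abs_mul]
    have h1 : |r ^ k| ≤ |r| := by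
      rw [abs_pow]
      exact pow_le_of_le_one (abs_nonneg r) hr (by omega)
    have h2 : |x ^ (5 + k) * y ^ (5 - k)| ≤ R := by
      have hm0 : 0 ≤ max |x| |y| := (abs_nonneg x).trans (le_max_left _ _)
      calc |x ^ (5 + k) * y ^ (5 - k)| = |x| ^ (5 + k) * |y| ^ (5 - k) := by
            rw [abs_mul, abs_pow, abs_pow]
        _ ≤ max |x| |y| ^ (5 + k) * max |x| |y| ^ (5 - k) := by
            gcongr <;> simp
        _ = max |x| |y| ^ 10 := by rw [← pow_add]; congr 1; omega
        _ ≤ R := by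
            have hn : Even 10 := by decide
            have h1 := hn.pow_nonneg x
            have h2 := hn.pow_nonneg y
            rcases max_choice |x| |y| with h | h <;> rw [hR, h, hn.pow_abs] <;> linarith
    gcongr
  have t1 := abs_le.1 (key 1 (by norm_num) (by norm_num))
  have t2 := abs_le.1 (key 2 (by norm_num) (by norm_num))
  have t3 := abs_le.1 (key 3 (by norm_num) (by norm_num))
  have t4 := abs_le.1 (key 4 (by norm_num) (by norm_num))
  have t5 := abs_le.1 (key 5 (by norm_num) (by norm_num))
  have e : x ^ 5 * (r * x + y) ^ 5 - x ^ 5 * y ^ 5 =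
      5 * (r ^ 1 * x ^ (5 + 1) * y ^ (5 - 1)) + 10 * (r ^ 2 * x ^ (5 + 2) * y ^ (5 - 2)) +
      10 * (r ^ 3 * x ^ (5 + 3) * y ^ (5 - 3)) + 5 * (r ^ 4 * x ^ (5 + 4) * y ^ (5 - 4)) +
      r ^ 5 * x ^ (5 + 5) * y ^ (5 - 5) := by norm_num; ring
  rw [e, mul_assoc 31, abs_le]
  constructor <;> linarith

theorem Submodule.dual_comp_prod_mem {Ω : Type*} (S : Submodule ℝ (Ω → ℝ)) (U W : Ω → ℝ)
    (hU : U ∈ S) (hW : W ∈ S) (L : StrongDual ℝ (ℝ × ℝ)) :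
    (fun ω => L (U ω, W ω)) ∈ S := by
  have : (fun ω => L (U ω, W ω)) = L (1, 0) • U + L (0, 1) • W := by
    ext ω
    have e : ((U ω, W ω) : ℝ × ℝ) = U ω • (1, 0) + W ω • (0, 1) := by simp
    rw [e, map_add, map_smul, map_smul]
    simp [mul_comm]
  rw [this]
  exact S.add_mem (S.smul_mem _ hU) (S.smul_mem _ hW)

namespace IsGaussianSpace

variable {Ω : Type*} [MeasurableSpace Ω] {P : Measure Ω} {S : Submodule ℝ (Ω → ℝ)}

theorem memLp (hS : IsGaussianSpace P S) {Z : Ω → ℝ} (hZ : Z ∈ S) {p : ENNReal}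
    (hp : p ≠ ⊤ := by simp) : MemLp Z p P := by
  obtain ⟨hm, v, hv⟩ := hS Z hZ
  have h := memLp_id_gaussianReal' (μ := 0) (v := v) p hp
  rw [← hv] at h
  exact h.comp_of_map hm.aemeasurable

theorem integrable_even_pow [IsProbabilityMeasure P] (hS : IsGaussianSpace P S) {Z : Ω → ℝ}
    (hZ : Z ∈ S) (s : ℕ) : Integrable (fun ω => Z ω ^ (2 * s)) P := by
  have h := (hS.memLp hZ (p := ((2 * s : ℕ) : ENNReal))
    (ENNReal.natCast_ne_top _)).integrable_norm_pow'
  refine h.congr (ae_of_all _ fun ω => ?_)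
  simp [pow_mul]

theorem integrable_mul (hS : IsGaussianSpace P S) {Z Z' : Ω → ℝ} (hZ : Z ∈ S) (hZ' : Z' ∈ S) :
    Integrable (fun ω => Z ω * Z' ω) P :=
  (hS.memLp hZ (p := 2)).integrable_mul (hS.memLp hZ' (p := 2))

theorem integral_even_pow (hS : IsGaussianSpace P S) {Z : Ω → ℝ} (hZ : Z ∈ S) (s : ℕ) :
    ∫ ω, Z ω ^ (2 * s) ∂P = (∫ ω, Z ω ^ 2 ∂P) ^ s * gaussianMoment s := by
  obtain ⟨hm, v, hv⟩ := hS Z hZ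
  have h : ∀ s, ∫ ω, Z ω ^ (2 * s) ∂P = (v : ℝ) ^ s * gaussianMoment s := fun s => by
    rw [← integral_even_pow_gaussianReal, ← hv, integral_map hm.aemeasurable (by fun_prop)]
  have h1 := h 1
  rw [gaussianMoment_one, mul_one, pow_one, mul_one] at h1
  rw [h, h1]

theorem map_neg_eq (hS : IsGaussianSpace P S) {Z : Ω → ℝ} (hZ : Z ∈ S) :
    P.map (-Z) = P.map Z := by
  obtain ⟨hm, v, hv⟩ := hS Z hZ
  have : P.map (-Z) = (P.map Z).map (fun x => -x) := by
    rw [Measure.map_map (by fun_prop) hm]; rfl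
  rw [this, hv, gaussianReal_map_neg, neg_zero]

theorem integral_eq_zero (hS : IsGaussianSpace P S) {Z : Ω → ℝ} (hZ : Z ∈ S) :
    ∫ ω, Z ω ∂P = 0 := by
  obtain ⟨hm, v, hv⟩ := hS Z hZ
  have := integral_map (μ := P) (φ := Z) hm.aemeasurable (f := fun x : ℝ => x) (by fun_prop)
  rw [← this, hv, integral_id_gaussianReal]

theorem integral_pow_five (hS : IsGaussianSpace P S) {Z : Ω → ℝ} (hZ : Z ∈ S) :
    ∫ ω, Z ω ^ 5 ∂P = 0 := by
  have h1 := integral_map (μ := P) (φ := Z) (hS Z hZ).1.aemeasurable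
    (f := fun x : ℝ => x ^ 5) (by fun_prop)
  have h2 := integral_map (μ := P) (φ := -Z) (hS Z hZ).1.neg.aemeasurable
    (f := fun x : ℝ => x ^ 5) (by fun_prop)
  rw [hS.map_neg_eq hZ, h1] at h2
  have h3 : ∀ ω, (-Z) ω ^ 5 = -(Z ω ^ 5) := fun ω => by simp only [Pi.neg_apply]; ring
  simp only [h3, integral_neg] at h2
  linarith

theorem map_neg_prod_eq [IsProbabilityMeasure P] (hS : IsGaussianSpace P S) {U W : Ω → ℝ}
    (hU : U ∈ S) (hW : W ∈ S) :
    P.map (fun ω => (-U ω, -W ω)) = P.map (fun ω => (U ω, W ω)) := by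
  have mU := (hS U hU).1
  have mW := (hS W hW).1
  have := Measure.isProbabilityMeasure_map (μ := P) (f := fun ω => (U ω, W ω)) (by fun_prop)
  have := Measure.isProbabilityMeasure_map (μ := P) (f := fun ω => (-U ω, -W ω)) (by fun_prop)
  apply Measure.ext_of_charFunDual
  ext L
  rw [charFunDual_eq_charFun_map_one, charFunDual_eq_charFun_map_one,
    Measure.map_map (by fun_prop) (by fun_prop), Measure.map_map (by fun_prop) (by fun_prop)]
  have h := hS.map_neg_eq (S.dual_comp_prod_mem U W hU hW L)
  have e : (L ∘ fun ω => (-U ω, -W ω)) = -(fun ω => L (U ω, W ω)) := by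
    ext ω
    have : ((-U ω, -W ω) : ℝ × ℝ) = -(U ω, W ω) := rfl
    simp [this, -Prod.neg_mk]
  rw [e, h]
  rfl

theorem indepFun_prod [IsProbabilityMeasure P] (hS : IsGaussianSpace P S) {U W X Y : Ω → ℝ}
    (hU : U ∈ S) (hW : W ∈ S) (hX : X ∈ S) (hY : Y ∈ S)
    (hUX : ∫ ω, U ω * X ω ∂P = 0) (hUY : ∫ ω, U ω * Y ω ∂P = 0)
    (hWX : ∫ ω, W ω * X ω ∂P = 0) (hWY : ∫ ω, W ω * Y ω ∂P = 0) :
    IndepFun (fun ω => (U ω, W ω)) (fun ω => (X ω, Y ω)) P := by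
  have mU := (hS U hU).1
  have mW := (hS W hW).1
  have mX := (hS X hX).1
  have mY := (hS Y hY).1
  have hcov : ∀ Z ∈ S, ∀ Z' ∈ S, cov[Z, Z'; P] = ∫ ω, Z ω * Z' ω ∂P := fun Z hZ Z' hZ' => by
    rw [covariance_eq_sub (hS.memLp hZ (p := 2)) (hS.memLp hZ' (p := 2)), hS.integral_eq_zero hZ,
      zero_mul, sub_zero]
    rfl
  refine HasGaussianLaw.indepFun_of_covariance_strongDual ⟨?_⟩ fun L₁ L₂ => ?_
  · refine isGaussian_of_map_eq_gaussianReal fun L => ?_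
    rw [Measure.map_map (by fun_prop) (by fun_prop)]
    have e : (L ∘ fun ω => ((U ω, W ω), (X ω, Y ω))) =
        (fun ω => (L.comp (.inl ℝ _ _)) (U ω, W ω)) + fun ω => (L.comp (.inr ℝ _ _)) (X ω, Y ω) := by
      ext ω
      simp [← map_add]
    obtain ⟨-, v, hv⟩ := hS _ (S.add_mem (S.dual_comp_prod_mem U W hU hW (L.comp (.inl ℝ _ _)))
      (S.dual_comp_prod_mem X Y hX hY (L.comp (.inr ℝ _ _))))
    exact ⟨0, v, by rw [e, hv]⟩
  · have h1 := S.dual_comp_prod_mem U W hU hW L₁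
    have h2 := S.dual_comp_prod_mem X Y hX hY L₂
    change cov[fun ω => L₁ (U ω, W ω), fun ω => L₂ (X ω, Y ω); P] = 0
    rw [hcov _ h1 _ h2]
    have e : ∀ ω, L₁ (U ω, W ω) * L₂ (X ω, Y ω) =
        L₁ (1, 0) * L₂ (1, 0) * (U ω * X ω) + L₁ (1, 0) * L₂ (0, 1) * (U ω * Y ω) +
        L₁ (0, 1) * L₂ (1, 0) * (W ω * X ω) + L₁ (0, 1) * L₂ (0, 1) * (W ω * Y ω) := by
      intro ω
      have e1 : ((U ω, W ω) : ℝ × ℝ) = U ω • (1, 0) + W ω • (0, 1) := by simp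
      have e2 : ((X ω, Y ω) : ℝ × ℝ) = X ω • (1, 0) + Y ω • (0, 1) := by simp
      rw [e1, e2, map_add, map_smul, map_smul, map_add, map_smul, map_smul]
      simp only [smul_eq_mul]
      ring
    simp_rw [e]
    have i1 := hS.integrable_mul hU hX
    have i2 := hS.integrable_mul hU hY
    have i3 := hS.integrable_mul hW hX
    have i4 := hS.integrable_mul hW hY
    rw [integral_add (by fun_prop) (by fun_prop), integral_add (by fun_prop) (by fun_prop),
      integral_add (by fun_prop) (by fun_prop)]
    simp [integral_const_mul, hUX, hUY, hWX, hWY]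

end IsGaussianSpace

theorem abs_pow_five_mul_pow_five_le (x y : ℝ) :
    |x ^ 5 * y ^ 5| ≤ (x ^ 10 + y ^ 10) / 2 := by
  rw [abs_le]
  constructor <;> nlinarith [sq_nonneg (x ^ 5 + y ^ 5), sq_nonneg (x ^ 5 - y ^ 5)]

namespace IsGaussianSpace

variable {Ω : Type*} [MeasurableSpace Ω] {P : Measure Ω} {S : Submodule ℝ (Ω → ℝ)}

theorem integrable_mul_pow_five [IsProbabilityMeasure P] (hS : IsGaussianSpace P S)
    {Z Z' : Ω → ℝ} (hZ : Z ∈ S) (hZ' : Z' ∈ S) {f : Ω → ℝ} (hf : Measurable f)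
    (hf1 : ∀ ω, |f ω| ≤ 1) : Integrable (fun ω => f ω * (Z ω ^ 5 * Z' ω ^ 5)) P := by
  have mZ := (hS Z hZ).1
  have mZ' := (hS Z' hZ').1
  refine (((hS.integrable_even_pow hZ 5).add (hS.integrable_even_pow hZ' 5)).div_const 2).mono'
    (by fun_prop) (ae_of_all _ fun ω => ?_)
  rw [Real.norm_eq_abs, abs_mul]
  calc |f ω| * |Z ω ^ 5 * Z' ω ^ 5| ≤ 1 * |Z ω ^ 5 * Z' ω ^ 5| := by gcongr; exact hf1 ω
    _ ≤ _ := by rw [one_mul]; exact abs_pow_five_mul_pow_five_le _ _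

theorem abs_integral_mul_pow_five_le [IsProbabilityMeasure P] (hS : IsGaussianSpace P S)
    {Z Z' : Ω → ℝ} (hZ : Z ∈ S) (hZ' : Z' ∈ S) (hZ1 : ∫ ω, Z ω ^ 2 ∂P = 1)
    (hZ1' : ∫ ω, Z' ω ^ 2 ∂P = 1) {f : Ω → ℝ} (hf1 : ∀ ω, |f ω| ≤ 1) :
    |∫ ω, f ω * (Z ω ^ 5 * Z' ω ^ 5) ∂P| ≤ gaussianMoment 5 := by
  have i1 := hS.integrable_even_pow hZ 5
  have i2 := hS.integrable_even_pow hZ' 5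
  have h := norm_integral_le_of_norm_le ((i1.add i2).div_const 2)
    (f := fun ω => f ω * (Z ω ^ 5 * Z' ω ^ 5)) (ae_of_all _ fun ω => by
      rw [Real.norm_eq_abs, abs_mul]
      calc |f ω| * |Z ω ^ 5 * Z' ω ^ 5| ≤ 1 * |Z ω ^ 5 * Z' ω ^ 5| := by gcongr; exact hf1 ω
        _ ≤ _ := by rw [one_mul]; exact abs_pow_five_mul_pow_five_le _ _)
  refine h.trans (le_of_eq ?_)
  simp only [Pi.add_apply]
  rw [integral_div, integral_add i1 i2, hS.integral_even_pow hZ, hS.integral_even_pow hZ', hZ1,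
    hZ1']
  ring

theorem abs_integral_orthogonal_perturbation_le [IsProbabilityMeasure P]
    (hS : IsGaussianSpace P S) {U W X Y : Ω → ℝ}
    (hU : U ∈ S) (hW : W ∈ S) (hX : X ∈ S) (hY : Y ∈ S)
    (hUX : ∫ ω, U ω * X ω ∂P = 0) (hUY : ∫ ω, U ω * Y ω ∂P = 0)
    (hWX : ∫ ω, W ω * X ω ∂P = 0) (hWY : ∫ ω, W ω * Y ω ∂P = 0)
    (hX1 : ∫ ω, X ω ^ 2 ∂P ≤ 1) (hY1 : ∫ ω, Y ω ^ 2 ∂P ≤ 1) {a b c d : ℝ}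
    (hM1 : ∫ ω, (a * U ω + b * W ω) ^ 2 ∂P ≤ 1) (hN1 : ∫ ω, (c * U ω + d * W ω) ^ 2 ∂P ≤ 1)
    {F : ℝ × ℝ → ℝ} (hF : Measurable F) (hF1 : ∀ z, |F z| ≤ 1) :
    |∫ ω, F (U ω, W ω) * ((a * U ω + b * W ω + X ω) ^ 5 * (c * U ω + d * W ω + Y ω) ^ 5) ∂P -
        (∫ ω, F (U ω, W ω) ∂P) * ∫ ω, X ω ^ 5 * Y ω ^ 5 ∂P| ≤
      1024 * (gaussianMoment 5 + 2 * gaussianMoment 4) *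
        (∫ ω, (a * U ω + b * W ω) ^ 2 ∂P + ∫ ω, (c * U ω + d * W ω) ^ 2 ∂P) := by
  have mU := (hS U hU).1
  have mW := (hS W hW).1
  have mX := (hS X hX).1
  have mY := (hS Y hY).1
  have hM : (fun ω => a * U ω + b * W ω) ∈ S := S.add_mem (S.smul_mem a hU) (S.smul_mem b hW)
  have hN : (fun ω => c * U ω + d * W ω) ∈ S := S.add_mem (S.smul_mem c hU) (S.smul_mem d hW)
  have hind := hS.indepFun_prod hU hW hX hY hUX hUY hWX hWY
  have hsymm : ∫ ω, F (U ω, W ω) *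
        ((a * U ω + b * W ω + X ω) ^ 5 * (c * U ω + d * W ω + Y ω) ^ 5) ∂P =
      ∫ ω, F (U ω, W ω) *
        ((a * U ω + b * W ω - X ω) ^ 5 * (c * U ω + d * W ω - Y ω) ^ 5) ∂P := by
    let G : (ℝ × ℝ) × (ℝ × ℝ) → ℝ := fun z => F z.1 *
      ((a * z.1.1 + b * z.1.2 + z.2.1) ^ 5 * (c * z.1.1 + d * z.1.2 + z.2.2) ^ 5)
    have hG : Measurable G := by fun_prop
    have hind' : IndepFun (fun ω => (U ω, W ω)) (fun ω => (-X ω, -Y ω)) P :=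
      hind.comp (φ := id) (ψ := fun z : ℝ × ℝ => (-z.1, -z.2)) measurable_id (by fun_prop)
    have hlaw : P.map (fun ω => ((U ω, W ω), (X ω, Y ω))) =
        P.map (fun ω => ((U ω, W ω), (-X ω, -Y ω))) := by
      rw [(indepFun_iff_map_prod_eq_prod_map_map (by fun_prop) (by fun_prop)).1 hind,
        (indepFun_iff_map_prod_eq_prod_map_map (by fun_prop) (by fun_prop)).1 hind',
        hS.map_neg_prod_eq hX hY]
    have h1 := integral_map (μ := P) (φ := fun ω => ((U ω, W ω), (X ω, Y ω))) (by fun_prop)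
      hG.aestronglyMeasurable
    have h2 := integral_map (μ := P) (φ := fun ω => ((U ω, W ω), (-X ω, -Y ω))) (by fun_prop)
      hG.aestronglyMeasurable
    rw [hlaw, h2] at h1
    simpa [G, sub_eq_add_neg] using h1.symm
  have hprod : ∫ ω, F (U ω, W ω) * (X ω ^ 5 * Y ω ^ 5) ∂P =
      (∫ ω, F (U ω, W ω) ∂P) * ∫ ω, X ω ^ 5 * Y ω ^ 5 ∂P :=
    hind.integral_fun_comp_mul_comp (f := F) (g := fun z : ℝ × ℝ => z.1 ^ 5 * z.2 ^ 5)
      (by fun_prop) (by fun_prop) (by fun_prop) (by fun_prop)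
  have hFm : Measurable fun ω => F (U ω, W ω) := by fun_prop
  have i1 := hS.integrable_mul_pow_five (S.add_mem hM hX) (S.add_mem hN hY) hFm fun ω => hF1 _
  have i2 := hS.integrable_mul_pow_five (S.sub_mem hM hX) (S.sub_mem hN hY) hFm fun ω => hF1 _
  have i3 := hS.integrable_mul_pow_five hX hY hFm fun ω => hF1 _
  simp only [Pi.add_apply, Pi.sub_apply] at i1 i2
  have hsum : ∫ ω, F (U ω, W ω) *
        ((a * U ω + b * W ω + X ω) ^ 5 * (c * U ω + d * W ω + Y ω) ^ 5) ∂P -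
        (∫ ω, F (U ω, W ω) ∂P) * ∫ ω, X ω ^ 5 * Y ω ^ 5 ∂P =
      ∫ ω, ((F (U ω, W ω) *
        ((a * U ω + b * W ω + X ω) ^ 5 * (c * U ω + d * W ω + Y ω) ^ 5) +
        F (U ω, W ω) *
        ((a * U ω + b * W ω - X ω) ^ 5 * (c * U ω + d * W ω - Y ω) ^ 5)) / 2 -
        F (U ω, W ω) * (X ω ^ 5 * Y ω ^ 5)) ∂P := by
    rw [integral_sub (by fun_prop) i3, integral_div, integral_add i1 i2, ← hsymm, hprod]
    ring
  have e1 := hS.integrable_even_pow hM 5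
  have e2 := hS.integrable_even_pow hN 5
  have hq : ∀ Z ∈ S, ∀ Z' ∈ S, Integrable (fun ω => Z ω ^ 2 * Z' ω ^ 8) P :=
      fun Z hZ Z' hZ' => by
    have mZ := (hS Z hZ).1
    have mZ' := (hS Z' hZ').1
    refine ((hS.integrable_even_pow hZ 5).add (hS.integrable_even_pow hZ' 5)).mono'
      (by fun_prop) (ae_of_all _ fun ω => ?_)
    rw [Real.norm_eq_abs]
    have := abs_monomial_le (a := Z ω) (b := 0) (c := Z' ω) (d := 0) (m := max |Z ω| |Z' ω|)
      (x := max |Z ω| |Z' ω|) (le_max_left _ _) (by simp) (le_max_right _ _) (by simp) 2 0 8 0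
    rw [← pow_add] at this
    simp only [pow_zero, mul_one] at this
    refine this.trans ?_
    have hn : Even 10 := by decide
    have h1 := hn.pow_nonneg (Z ω)
    have h2 := hn.pow_nonneg (Z' ω)
    rcases max_choice |Z ω| |Z' ω| with h | h <;> rw [h, hn.pow_abs] <;> simp [h1, h2]
  have e3 := hq _ hM _ hX
  have e4 := hq _ hM _ hY
  have e5 := hq _ hN _ hX
  have e6 := hq _ hN _ hY
  rw [hsum]
  have hbound := norm_integral_le_of_norm_le (((e1.add e2).add
      ((e3.add e4).add (e5.add e6))).const_mul 1024) (f := fun ω => (F (U ω, W ω) *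
        ((a * U ω + b * W ω + X ω) ^ 5 * (c * U ω + d * W ω + Y ω) ^ 5) +
        F (U ω, W ω) *
        ((a * U ω + b * W ω - X ω) ^ 5 * (c * U ω + d * W ω - Y ω) ^ 5)) / 2 -
        F (U ω, W ω) * (X ω ^ 5 * Y ω ^ 5)) (ae_of_all _ fun ω => by
      have h := abs_symmetrized_fifth_powers_le (a * U ω + b * W ω) (c * U ω + d * W ω)
        (X ω) (Y ω)
      have hR := (abs_nonneg _).trans h
      rw [Real.norm_eq_abs, show (F (U ω, W ω) *
        ((a * U ω + b * W ω + X ω) ^ 5 * (c * U ω + d * W ω + Y ω) ^ 5) +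
        F (U ω, W ω) *
        ((a * U ω + b * W ω - X ω) ^ 5 * (c * U ω + d * W ω - Y ω) ^ 5)) / 2 -
        F (U ω, W ω) * (X ω ^ 5 * Y ω ^ 5) = F (U ω, W ω) *
        (((a * U ω + b * W ω + X ω) ^ 5 * (c * U ω + d * W ω + Y ω) ^ 5 +
        (a * U ω + b * W ω - X ω) ^ 5 * (c * U ω + d * W ω - Y ω) ^ 5) / 2 -
        X ω ^ 5 * Y ω ^ 5) by ring, abs_mul]
      refine (mul_le_of_le_one_left (abs_nonneg _) (hF1 _)).trans (h.trans (le_of_eq ?_))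
      simp only [Pi.add_apply]
      ring)
  refine hbound.trans ?_
  simp only [Pi.add_apply]
  rw [integral_const_mul, integral_add (by fun_prop) (by fun_prop),
    integral_add (by fun_prop) (by fun_prop), integral_add (by fun_prop) (by fun_prop), integral_add e3 e4,
    integral_add e5 e6]
  have p1 : ∫ ω, (a * U ω + b * W ω) ^ 2 * X ω ^ 8 ∂P =
      (∫ ω, (a * U ω + b * W ω) ^ 2 ∂P) * ∫ ω, X ω ^ (2 * 4) ∂P :=
    hind.integral_fun_comp_mul_comp (f := fun z : ℝ × ℝ => (a * z.1 + b * z.2) ^ 2)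
      (g := fun z : ℝ × ℝ => z.1 ^ 8) (by fun_prop) (by fun_prop) (by fun_prop) (by fun_prop)
  have p2 : ∫ ω, (a * U ω + b * W ω) ^ 2 * Y ω ^ 8 ∂P =
      (∫ ω, (a * U ω + b * W ω) ^ 2 ∂P) * ∫ ω, Y ω ^ (2 * 4) ∂P :=
    hind.integral_fun_comp_mul_comp (f := fun z : ℝ × ℝ => (a * z.1 + b * z.2) ^ 2)
      (g := fun z : ℝ × ℝ => z.2 ^ 8) (by fun_prop) (by fun_prop) (by fun_prop) (by fun_prop)
  have p3 : ∫ ω, (c * U ω + d * W ω) ^ 2 * X ω ^ 8 ∂P =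
      (∫ ω, (c * U ω + d * W ω) ^ 2 ∂P) * ∫ ω, X ω ^ (2 * 4) ∂P :=
    hind.integral_fun_comp_mul_comp (f := fun z : ℝ × ℝ => (c * z.1 + d * z.2) ^ 2)
      (g := fun z : ℝ × ℝ => z.1 ^ 8) (by fun_prop) (by fun_prop) (by fun_prop) (by fun_prop)
  have p4 : ∫ ω, (c * U ω + d * W ω) ^ 2 * Y ω ^ 8 ∂P =
      (∫ ω, (c * U ω + d * W ω) ^ 2 ∂P) * ∫ ω, Y ω ^ (2 * 4) ∂P :=
    hind.integral_fun_comp_mul_comp (f := fun z : ℝ × ℝ => (c * z.1 + d * z.2) ^ 2)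
      (g := fun z : ℝ × ℝ => z.2 ^ 8) (by fun_prop) (by fun_prop) (by fun_prop) (by fun_prop)
  have q1 := hS.integral_even_pow hM 5
  have q2 := hS.integral_even_pow hN 5
  rw [p1, p2, p3, p4, hS.integral_even_pow hX, hS.integral_even_pow hY, q1, q2]
  have nn : ∀ Z : Ω → ℝ, 0 ≤ ∫ ω, Z ω ^ 2 ∂P := fun Z => integral_nonneg fun ω => sq_nonneg _
  have m4 := gaussianMoment_nonneg 4
  have m5 := gaussianMoment_nonneg 5
  have r1 := pow_le_one₀ (n := 4) (nn X) hX1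
  have r2 := pow_le_one₀ (n := 4) (nn Y) hY1
  have nM := nn fun ω => a * U ω + b * W ω
  have nN := nn fun ω => c * U ω + d * W ω
  have r3 := pow_le_of_le_one nM hM1 (n := 5) (by norm_num)
  have r4 := pow_le_of_le_one nN hN1 (n := 5) (by norm_num)
  generalize (∫ ω, (a * U ω + b * W ω) ^ 2 ∂P) = M at *
  generalize (∫ ω, (c * U ω + d * W ω) ^ 2 ∂P) = N at *
  generalize (∫ ω, X ω ^ 2 ∂P) ^ 4 = x at *
  generalize (∫ ω, Y ω ^ 2 ∂P) ^ 4 = y at *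
  have s1 := mul_le_mul_of_nonneg_right r3 m5
  have s2 := mul_le_mul_of_nonneg_right r4 m5
  have s3 := mul_le_mul_of_nonneg_left (mul_le_mul_of_nonneg_right r1 m4) (add_nonneg nM nN)
  have s4 := mul_le_mul_of_nonneg_left (mul_le_mul_of_nonneg_right r2 m4) (add_nonneg nM nN)
  nlinarith

end IsGaussianSpace

theorem regression_coefficients_bound {r x y : ℝ} (hr : |r| ≤ 1 / 2) :
    ∃ a b : ℝ, a + b * r = x ∧ a * r + b = y ∧
      a * x + b * y ≤ 2 * (x ^ 2 + y ^ 2) := by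
  have hr' := abs_le.1 hr
  have hp : 0 < 1 - r ^ 2 := by nlinarith
  refine ⟨(x - r * y) / (1 - r ^ 2), (y - r * x) / (1 - r ^ 2), by field_simp; ring,
    by field_simp; ring, ?_⟩
  have : (x - r * y) / (1 - r ^ 2) * x + (y - r * x) / (1 - r ^ 2) * y =
    (x ^ 2 + y ^ 2 - 2 * r * x * y) / (1 - r ^ 2) := by ring
  rw [this, div_le_iff₀ hp]
  nlinarith [mul_nonneg (by nlinarith : 0 ≤ (1 + 2 * r) * (1 - r)) (sq_nonneg (x + y)),
    mul_nonneg (by nlinarith : 0 ≤ (1 - 2 * r) * (1 + r)) (sq_nonneg (x - y))]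

namespace IsGaussianSpace

variable {Ω : Type*} [MeasurableSpace Ω] {P : Measure Ω} {S : Submodule ℝ (Ω → ℝ)}

theorem integral_linear_comb_mul (hS : IsGaussianSpace P S) {U W Z : Ω → ℝ}
    (hU : U ∈ S) (hW : W ∈ S) (hZ : Z ∈ S) (a b : ℝ) :
    ∫ ω, (a * U ω + b * W ω) * Z ω ∂P = a * ∫ ω, U ω * Z ω ∂P + b * ∫ ω, W ω * Z ω ∂P := by
  have i1 := hS.integrable_mul hU hZ
  have i2 := hS.integrable_mul hW hZ
  simp_rw [add_mul, mul_assoc]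
  rw [integral_add (by fun_prop) (by fun_prop), integral_const_mul, integral_const_mul]

theorem integral_linear_comb_sq (hS : IsGaussianSpace P S) {U W : Ω → ℝ}
    (hU : U ∈ S) (hW : W ∈ S) (a b : ℝ) :
    ∫ ω, (a * U ω + b * W ω) ^ 2 ∂P = a ^ 2 * ∫ ω, U ω ^ 2 ∂P +
      2 * a * b * ∫ ω, U ω * W ω ∂P + b ^ 2 * ∫ ω, W ω ^ 2 ∂P := by
  have i1 := hS.integrable_mul hU hU
  have i2 := hS.integrable_mul hU hW
  have i3 := hS.integrable_mul hW hW
  have e : ∀ ω, (a * U ω + b * W ω) ^ 2 = a ^ 2 * (U ω * U ω) + 2 * a * b * (U ω * W ω) +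
    b ^ 2 * (W ω * W ω) := fun ω => by ring
  simp_rw [e]
  rw [integral_add (by fun_prop) (by fun_prop), integral_add (by fun_prop) (by fun_prop),
    integral_const_mul, integral_const_mul, integral_const_mul]
  simp only [sq]

theorem abs_integral_pow_five_mul_pow_five_le [IsProbabilityMeasure P]
    (hS : IsGaussianSpace P S) {X Y : Ω → ℝ} (hX : X ∈ S) (hY : Y ∈ S)
    (hX1 : ∫ ω, X ω ^ 2 ∂P = 1) (hY1 : ∫ ω, Y ω ^ 2 ∂P = 1) :
    |∫ ω, X ω ^ 5 * Y ω ^ 5 ∂P| ≤ 62 * gaussianMoment 5 * |∫ ω, X ω * Y ω ∂P| := by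
  set ρ := ∫ ω, X ω * Y ω ∂P with hρ
  have hZ : (fun ω => -ρ * X ω + 1 * Y ω) ∈ S := S.add_mem (S.smul_mem _ hX) (S.smul_mem _ hY)
  set Z : Ω → ℝ := fun ω => -ρ * X ω + 1 * Y ω with hZdef
  have hZX : ∫ ω, Z ω * X ω ∂P = 0 := by
    have := hS.integral_linear_comb_mul hX hY hX (-ρ) 1
    have e : ∫ ω, Y ω * X ω ∂P = ρ := by simp_rw [mul_comm, hρ]
    simp only [hZdef]
    rw [this, e, show ∫ ω, X ω * X ω ∂P = 1 by simpa [sq] using hX1]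
    ring
  have hXZ : ∫ ω, X ω * Z ω ∂P = 0 := by simpa [mul_comm] using hZX
  have hZ2 : ∫ ω, Z ω ^ 2 ∂P = 1 - ρ ^ 2 := by
    rw [hS.integral_linear_comb_sq hX hY, ← hρ, hX1, hY1]
    ring
  have hρ2 : 0 ≤ 1 - ρ ^ 2 := hZ2 ▸ integral_nonneg fun ω => sq_nonneg _
  have hρ1 : |ρ| ≤ 1 := by
    rw [← sq_abs] at hρ2
    nlinarith [abs_nonneg ρ]
  have hind := hS.indepFun_prod hX hX hZ hZ hXZ hXZ hXZ hXZ
  have mX := (hS X hX).1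
  have mZ := (hS Z hZ).1
  have hprod : ∫ ω, X ω ^ 5 * Z ω ^ 5 ∂P = (∫ ω, X ω ^ 5 ∂P) * ∫ ω, Z ω ^ 5 ∂P :=
    hind.integral_fun_comp_mul_comp (f := fun z : ℝ × ℝ => z.1 ^ 5)
      (g := fun z : ℝ × ℝ => z.1 ^ 5) (by fun_prop) (by fun_prop) (by fun_prop) (by fun_prop)
  rw [hS.integral_pow_five hX, zero_mul] at hprod
  have i1 := hS.integrable_mul_pow_five hX hY (f := fun _ => 1) (by fun_prop) (by simp)
  have i2 := hS.integrable_mul_pow_five hX hZ (f := fun _ => 1) (by fun_prop) (by simp)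
  simp only [one_mul] at i1 i2
  have e1 := hS.integrable_even_pow hX 5
  have e2 := hS.integrable_even_pow hZ 5
  have hdiff : ∫ ω, X ω ^ 5 * Y ω ^ 5 ∂P = ∫ ω, (X ω ^ 5 * Y ω ^ 5 - X ω ^ 5 * Z ω ^ 5) ∂P := by
    rw [integral_sub i1 i2, hprod, sub_zero]
  rw [hdiff]
  have h := norm_integral_le_of_norm_le
    (g := fun ω => 31 * |ρ| * (X ω ^ (2 * 5) + Z ω ^ (2 * 5))) (by fun_prop)
    (f := fun ω => X ω ^ 5 * Y ω ^ 5 - X ω ^ 5 * Z ω ^ 5) (ae_of_all P fun ω => by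
      have h := abs_fifth_powers_sub_le hρ1 (X ω) (Z ω)
      have e : ρ * X ω + Z ω = Y ω := by simp only [hZdef]; ring
      rwa [e] at h)
  refine h.trans ?_
  rw [integral_const_mul, integral_add e1 e2, hS.integral_even_pow hX, hS.integral_even_pow hZ,
    hX1, hZ2]
  have h5 := gaussianMoment_nonneg 5
  have h6 : (1 - ρ ^ 2) ^ 5 ≤ 1 := pow_le_one₀ hρ2 (by nlinarith [sq_nonneg ρ])
  have h7 := mul_le_mul_of_nonneg_right h6 (mul_nonneg (abs_nonneg ρ) h5)
  nlinarith

theorem exists_regression (hS : IsGaussianSpace P S) {U W X : Ω → ℝ}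
    (hU : U ∈ S) (hW : W ∈ S) (hX : X ∈ S)
    (hU1 : ∫ ω, U ω ^ 2 ∂P = 1) (hW1 : ∫ ω, W ω ^ 2 ∂P = 1) (hX1 : ∫ ω, X ω ^ 2 ∂P = 1)
    (hUW : |∫ ω, U ω * W ω ∂P| ≤ 1 / 2) :
    ∃ a b : ℝ, ∃ ξ ∈ S, (∀ ω, X ω = a * U ω + b * W ω + ξ ω) ∧
      ∫ ω, U ω * ξ ω ∂P = 0 ∧ ∫ ω, W ω * ξ ω ∂P = 0 ∧ ∫ ω, ξ ω ^ 2 ∂P ≤ 1 ∧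
      ∫ ω, (a * U ω + b * W ω) ^ 2 ∂P ≤ 1 ∧
      ∫ ω, (a * U ω + b * W ω) ^ 2 ∂P ≤
        2 * ((∫ ω, X ω * U ω ∂P) ^ 2 + (∫ ω, X ω * W ω ∂P) ^ 2) := by
  obtain ⟨a, b, hx, hy, hab⟩ := regression_coefficients_bound (x := ∫ ω, X ω * U ω ∂P)
    (y := ∫ ω, X ω * W ω ∂P) hUW
  have hM : (fun ω => a * U ω + b * W ω) ∈ S := S.add_mem (S.smul_mem a hU) (S.smul_mem b hW)
  have hξ : (fun ω => 1 * X ω + (-1) * (a * U ω + b * W ω)) ∈ S :=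
    S.add_mem (S.smul_mem _ hX) (S.smul_mem (-1) hM)
  have hU1' : ∫ ω, U ω * U ω ∂P = 1 := by simpa [sq] using hU1
  have hW1' : ∫ ω, W ω * W ω ∂P = 1 := by simpa [sq] using hW1
  have hWU : ∫ ω, W ω * U ω ∂P = ∫ ω, U ω * W ω ∂P := by simp_rw [mul_comm]
  have hUX : ∫ ω, U ω * X ω ∂P = ∫ ω, X ω * U ω ∂P := by simp_rw [mul_comm]
  have hWX : ∫ ω, W ω * X ω ∂P = ∫ ω, X ω * W ω ∂P := by simp_rw [mul_comm]
  have hM2 : ∫ ω, (a * U ω + b * W ω) ^ 2 ∂P =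
      a * ∫ ω, X ω * U ω ∂P + b * ∫ ω, X ω * W ω ∂P := by
    rw [hS.integral_linear_comb_sq hU hW, hU1, hW1, ← hx, ← hy]
    ring
  have hMX : ∫ ω, X ω * (a * U ω + b * W ω) ∂P =
      a * ∫ ω, X ω * U ω ∂P + b * ∫ ω, X ω * W ω ∂P := by
    rw [← hUX, ← hWX, ← hS.integral_linear_comb_mul hU hW hX]
    simp_rw [mul_comm]
  have hξ2 := hS.integral_linear_comb_sq hX hM 1 (-1)
  rw [hX1, hMX, hM2] at hξ2
  have nM : 0 ≤ ∫ ω, (a * U ω + b * W ω) ^ 2 ∂P := integral_nonneg fun ω => sq_nonneg _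
  have nξ : 0 ≤ ∫ ω, (1 * X ω + (-1) * (a * U ω + b * W ω)) ^ 2 ∂P :=
    integral_nonneg fun ω => sq_nonneg _
  refine ⟨a, b, _, hξ, fun ω => by ring, ?_, ?_, by linarith, by linarith, by linarith⟩
  · have h1 := hS.integral_linear_comb_mul hX hM hU 1 (-1)
    rw [hS.integral_linear_comb_mul hU hW hU, hU1', hWU] at h1
    simp_rw [mul_comm (U _)]
    rw [h1, ← hx]
    ring
  · have h1 := hS.integral_linear_comb_mul hX hM hW 1 (-1)
    rw [hS.integral_linear_comb_mul hU hW hW, hW1'] at h1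
    simp_rw [mul_comm (W _)]
    rw [h1, ← hy]
    ring

theorem abs_integral_weighted_pow_five_le [IsProbabilityMeasure P]
    (hS : IsGaussianSpace P S) {U W X Y : Ω → ℝ}
    (hU : U ∈ S) (hW : W ∈ S) (hX : X ∈ S) (hY : Y ∈ S)
    (hU1 : ∫ ω, U ω ^ 2 ∂P = 1) (hW1 : ∫ ω, W ω ^ 2 ∂P = 1)
    (hX1 : ∫ ω, X ω ^ 2 ∂P = 1) (hY1 : ∫ ω, Y ω ^ 2 ∂P = 1)
    (hUW : |∫ ω, U ω * W ω ∂P| ≤ 1 / 2)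
    {F : ℝ × ℝ → ℝ} (hF : Measurable F) (hF1 : ∀ z, |F z| ≤ 1) :
    |∫ ω, F (U ω, W ω) * (X ω ^ 5 * Y ω ^ 5) ∂P| ≤
      4096 * (gaussianMoment 5 + 2 * gaussianMoment 4) *
        (|∫ ω, X ω * Y ω ∂P| + (∫ ω, X ω * U ω ∂P) ^ 2 + (∫ ω, X ω * W ω ∂P) ^ 2 +
          (∫ ω, Y ω * U ω ∂P) ^ 2 + (∫ ω, Y ω * W ω ∂P) ^ 2) := by
  obtain ⟨a, b, ξ, hξ, eX, hUξ, hWξ, hξ1, hM1, hM2⟩ :=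
    hS.exists_regression hU hW hX hU1 hW1 hX1 hUW
  obtain ⟨c, d, η, hη, eY, hUη, hWη, hη1, hN1, hN2⟩ :=
    hS.exists_regression hU hW hY hU1 hW1 hY1 hUW
  have h1 := hS.abs_integral_orthogonal_perturbation_le hU hW hξ hη hUξ hUη hWξ hWη hξ1 hη1
    hM1 hN1 hF hF1
  have h2 := hS.abs_integral_orthogonal_perturbation_le hU hW hξ hη hUξ hUη hWξ hWη hξ1 hη1
    hM1 hN1 (F := fun _ => 1) measurable_const (by simp)
  have h3 := hS.abs_integral_pow_five_mul_pow_five_le hX hY hX1 hY1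
  simp only [← eX, ← eY, one_mul, integral_const, smul_eq_mul, mul_one, probReal_univ] at h1 h2
  have hI : |∫ ω, F (U ω, W ω) ∂P| ≤ 1 := by
    have := norm_integral_le_of_norm_le_const (μ := P) (f := fun ω => F (U ω, W ω)) (C := 1)
      (ae_of_all _ fun ω => hF1 _)
    simpa using this
  have g4 := gaussianMoment_nonneg 4
  have g5 := gaussianMoment_nonneg 5
  generalize (∫ ω, F (U ω, W ω) * (X ω ^ 5 * Y ω ^ 5) ∂P) = I at *
  generalize (∫ ω, F (U ω, W ω) ∂P) = f at *
  generalize (∫ ω, ξ ω ^ 5 * η ω ^ 5 ∂P) = J at *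
  generalize (∫ ω, X ω ^ 5 * Y ω ^ 5 ∂P) = G at *
  have hJ : |f * J| ≤ |J| := by
    rw [abs_mul]
    exact mul_le_of_le_one_left (abs_nonneg _) hI
  have hIJ : |I| ≤ |I - f * J| + |G - J| + |G| := by
    have t1 := abs_sub_abs_le_abs_sub I (f * J)
    have t2 := abs_sub_abs_le_abs_sub J G
    rw [abs_sub_comm] at t2
    linarith
  have hK : 0 ≤ gaussianMoment 5 + 2 * gaussianMoment 4 := by positivity
  have t1 := mul_le_mul_of_nonneg_left hM2 hK
  have t2 := mul_le_mul_of_nonneg_left hN2 hK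
  have t3 := mul_nonneg g4 (abs_nonneg (∫ ω, X ω * Y ω ∂P))
  have t4 := mul_nonneg g5 (abs_nonneg (∫ ω, X ω * Y ω ∂P))
  nlinarith

end IsGaussianSpace

namespace IsGaussianSpace

variable {Ω : Type*} [MeasurableSpace Ω] {P : Measure Ω} {S : Submodule ℝ (Ω → ℝ)}

theorem abs_integral_weighted_pow_five_le_of_one_le [IsProbabilityMeasure P]
    (hS : IsGaussianSpace P S) {U W X Y : Ω → ℝ}
    (hU : U ∈ S) (hW : W ∈ S) (hX : X ∈ S) (hY : Y ∈ S)
    (hU1 : 1 ≤ ∫ ω, U ω ^ 2 ∂P) (hW1 : 1 ≤ ∫ ω, W ω ^ 2 ∂P)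
    (hX1 : ∫ ω, X ω ^ 2 ∂P = 1) (hY1 : ∫ ω, Y ω ^ 2 ∂P = 1)
    (hUW : 4 * (∫ ω, U ω * W ω ∂P) ^ 2 ≤ (∫ ω, U ω ^ 2 ∂P) * ∫ ω, W ω ^ 2 ∂P)
    {F : ℝ × ℝ → ℝ} (hF : Measurable F) (hF1 : ∀ z, |F z| ≤ 1) :
    |∫ ω, F (U ω, W ω) * (X ω ^ 5 * Y ω ^ 5) ∂P| ≤
      4096 * (gaussianMoment 5 + 2 * gaussianMoment 4) *
        (|∫ ω, X ω * Y ω ∂P| + (∫ ω, X ω * U ω ∂P) ^ 2 + (∫ ω, X ω * W ω ∂P) ^ 2 +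
          (∫ ω, Y ω * U ω ∂P) ^ 2 + (∫ ω, Y ω * W ω ∂P) ^ 2) := by
  set p := ∫ ω, U ω ^ 2 ∂P with hp
  set q := ∫ ω, W ω ^ 2 ∂P with hq
  have sp : 0 < √p := Real.sqrt_pos.2 (by linarith)
  have sq' : 0 < √q := Real.sqrt_pos.2 (by linarith)
  have ep : √p ^ 2 = p := Real.sq_sqrt (by linarith)
  have eq : √q ^ 2 = q := Real.sq_sqrt (by linarith)
  have hU' : (fun ω => (√p)⁻¹ * U ω) ∈ S := S.smul_mem _ hU
  have hW' : (fun ω => (√q)⁻¹ * W ω) ∈ S := S.smul_mem _ hW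
  have h := hS.abs_integral_weighted_pow_five_le hU' hW' hX hY
    (by simp_rw [mul_pow]; rw [integral_const_mul, inv_pow, ep, ← hp, inv_mul_cancel₀]; linarith)
    (by simp_rw [mul_pow]; rw [integral_const_mul, inv_pow, eq, ← hq, inv_mul_cancel₀]; linarith)
    hX1 hY1 (by
      have e : ∀ ω, (√p)⁻¹ * U ω * ((√q)⁻¹ * W ω) = (√p * √q)⁻¹ * (U ω * W ω) := fun ω => by
        field_simp
      simp_rw [e]
      rw [integral_const_mul, abs_mul, abs_of_pos (by positivity), inv_mul_le_iff₀ (by positivity)]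
      refine abs_le_of_sq_le_sq ?_ (by positivity)
      rw [mul_pow, mul_pow, ep, eq]
      linarith)
    (F := fun z => F (√p * z.1, √q * z.2)) (by fun_prop) (fun z => hF1 _)
  have e1 : ∀ Z : Ω → ℝ, (∫ ω, Z ω * ((√p)⁻¹ * U ω) ∂P) ^ 2 ≤ (∫ ω, Z ω * U ω ∂P) ^ 2 :=
      fun Z => by
    simp_rw [mul_left_comm (Z _)]
    rw [integral_const_mul, mul_pow, inv_pow, ep]
    exact mul_le_of_le_one_left (sq_nonneg _) (inv_le_one_of_one_le₀ hU1)
  have e2 : ∀ Z : Ω → ℝ, (∫ ω, Z ω * ((√q)⁻¹ * W ω) ∂P) ^ 2 ≤ (∫ ω, Z ω * W ω ∂P) ^ 2 :=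
      fun Z => by
    simp_rw [mul_left_comm (Z _)]
    rw [integral_const_mul, mul_pow, inv_pow, eq]
    exact mul_le_of_le_one_left (sq_nonneg _) (inv_le_one_of_one_le₀ hW1)
  simp only [mul_inv_cancel_left₀ sp.ne', mul_inv_cancel_left₀ sq'.ne'] at h
  refine h.trans ?_
  have g4 := gaussianMoment_nonneg 4
  have g5 := gaussianMoment_nonneg 5
  have hK : 0 ≤ 4096 * (gaussianMoment 5 + 2 * gaussianMoment 4) := by positivity
  refine mul_le_mul_of_nonneg_left ?_ hK
  linarith [e1 X, e1 Y, e2 X, e2 Y]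

end IsGaussianSpace

/-- The cube root of a natural number. -/
def cubeRoot (k : ℕ) : ℝ := (k : ℝ) ^ ((1 : ℝ) / 3)

theorem cubeRoot_pow_three (k : ℕ) : cubeRoot k ^ 3 = k := by
  rw [cubeRoot, ← Real.rpow_natCast, ← Real.rpow_mul (by positivity)]
  norm_num

theorem cubeRoot_zero : cubeRoot 0 = 0 := by simp [cubeRoot]

theorem cubeRoot_one : cubeRoot 1 = 1 := by simp [cubeRoot]

theorem cubeRoot_nonneg (k : ℕ) : 0 ≤ cubeRoot k := by unfold cubeRoot; positivity

theorem cubeRoot_mono : Monotone cubeRoot := fun a b h => by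
  unfold cubeRoot
  gcongr

theorem one_le_cubeRoot_succ (k : ℕ) : 1 ≤ cubeRoot (k + 1) :=
  cubeRoot_one ▸ cubeRoot_mono (Nat.le_add_left 1 k)

theorem three_le_cubeRoot {k : ℕ} (hk : 27 ≤ k) : 3 ≤ cubeRoot k := by
  have h := cubeRoot_pow_three k
  have hk' : (27 : ℝ) ≤ k := by exact_mod_cast hk
  by_contra! hlt
  have := pow_lt_pow_left₀ hlt (cubeRoot_nonneg k) (n := 3) (by norm_num)
  linarith

theorem cubeRoot_add_le (a b : ℕ) : cubeRoot (a + b) ≤ cubeRoot a + cubeRoot b := by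
  unfold cubeRoot
  push_cast
  exact Real.rpow_add_le_add_rpow (by positivity) (by positivity) (by norm_num) (by norm_num)

theorem cubeRoot_succ_sub_mul_sq_le (k : ℕ) :
    (cubeRoot (k + 1) - cubeRoot k) * cubeRoot (k + 1) ^ 2 ≤ 1 := by
  have h0 := cubeRoot_pow_three k
  have h1 := cubeRoot_pow_three (k + 1)
  have n0 := cubeRoot_nonneg k
  have m := cubeRoot_mono (Nat.le_add_right k 1)
  push_cast at h1
  nlinarith [mul_nonneg (sub_nonneg.2 m) (mul_nonneg n0 (n0.trans m)),
    mul_nonneg (sub_nonneg.2 m) (sq_nonneg (cubeRoot k))]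

theorem cubeRoot_succ_sub_le (k : ℕ) :
    cubeRoot (k + 1) - cubeRoot k ≤ (cubeRoot (k + 1) ^ 2)⁻¹ := by
  have := one_le_cubeRoot_succ k
  rw [← one_div, le_div_iff₀ (by positivity)]
  exact cubeRoot_succ_sub_mul_sq_le k

theorem cubeRoot_succ_sub_antitone :
    Antitone fun k => cubeRoot (k + 1) - cubeRoot k := by
  refine antitone_nat_of_succ_le fun k => ?_
  have h0 := cubeRoot_pow_three k
  have h1 := cubeRoot_pow_three (k + 1)
  have h2 := cubeRoot_pow_three (k + 1 + 1)
  have n0 := cubeRoot_nonneg k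
  have n1 := one_le_cubeRoot_succ k
  have m1 := cubeRoot_mono (Nat.le_add_right k 1)
  have m2 := cubeRoot_mono (Nat.le_add_right (k + 1) 1)
  push_cast at h1 h2
  generalize cubeRoot k = x at *
  generalize cubeRoot (k + 1) = y at *
  generalize cubeRoot (k + 1 + 1) = z at *
  have hy : 0 < y ^ 2 + y * x + x ^ 2 := by nlinarith
  have hz : 0 < z ^ 2 + z * y + y ^ 2 := by nlinarith
  have e1 : y - x = 1 / (y ^ 2 + y * x + x ^ 2) := by
    rw [eq_div_iff hy.ne']; nlinarith
  have e2 : z - y = 1 / (z ^ 2 + z * y + y ^ 2) := by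
    rw [eq_div_iff hz.ne']; nlinarith
  rw [e1, e2]
  refine one_div_le_one_div_of_le hy ?_
  nlinarith

theorem summable_inv_cubeRoot_pow_four : Summable fun k => (cubeRoot (k + 1) ^ 4)⁻¹ := by
  have h := (Real.summable_nat_rpow_inv (p := 4 / 3)).2 (by norm_num)
  refine ((summable_nat_add_iff 1).2 h).congr fun k => ?_
  rw [cubeRoot, ← Real.rpow_natCast, ← Real.rpow_mul (by positivity)]
  norm_num

theorem summable_cubeRoot_second_difference :
    Summable fun k => (cubeRoot (k + 1) - cubeRoot k) -
      (cubeRoot (k + 1 + 1) - cubeRoot (k + 1)) := by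
  refine summable_of_sum_range_le (c := 1) (fun k => ?_) fun n => ?_
  · exact sub_nonneg.2 (cubeRoot_succ_sub_antitone (Nat.le_add_right k 1))
  · rw [Finset.sum_range_sub' (fun k => cubeRoot (k + 1) - cubeRoot k)]
    have := cubeRoot_mono (Nat.le_add_right n 1)
    simp only [zero_add, cubeRoot_zero, cubeRoot_one]
    linarith

/-- The covariance structure, on the integers, of a fractional Brownian motion of Hurst
parameter `1/6`. -/
def HasFBMCovariance {Ω : Type*} [MeasurableSpace Ω] (P : Measure Ω) (b : ℕ → Ω → ℝ) : Prop :=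
  ∀ i k, ∫ ω, b i ω * b (i + k) ω ∂P = (cubeRoot i + cubeRoot (i + k) - cubeRoot k) / 2

theorem four_mul_sq_le_mul {t p q : ℝ} (hp : 1 ≤ p) (hq : 9 ≤ q) (h : 2 * t ≤ 3)
    (htp : -p ≤ 2 * t) (htq : -q ≤ 2 * t) : 4 * t ^ 2 ≤ p * q := by
  rcases le_total 0 t with ht | ht <;> nlinarith

namespace IsGaussianSpace

variable {Ω : Type*} [MeasurableSpace Ω] {P : Measure Ω} {S : Submodule ℝ (Ω → ℝ)}

theorem integral_linear_comb_mul_linear_comb (hS : IsGaussianSpace P S) {U W X Y : Ω → ℝ}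
    (hU : U ∈ S) (hW : W ∈ S) (hX : X ∈ S) (hY : Y ∈ S) (a b c d : ℝ) :
    ∫ ω, (a * U ω + b * W ω) * (c * X ω + d * Y ω) ∂P =
      a * c * ∫ ω, U ω * X ω ∂P + a * d * ∫ ω, U ω * Y ω ∂P +
        b * c * ∫ ω, W ω * X ω ∂P + b * d * ∫ ω, W ω * Y ω ∂P := by
  have hXY : (fun ω => c * X ω + d * Y ω) ∈ S := S.add_mem (S.smul_mem c hX) (S.smul_mem d hY)
  have h : ∀ Z ∈ S, ∫ ω, Z ω * (c * X ω + d * Y ω) ∂P =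
      c * ∫ ω, Z ω * X ω ∂P + d * ∫ ω, Z ω * Y ω ∂P := fun Z hZ => by
    simpa only [mul_comm (Z _)] using hS.integral_linear_comb_mul hX hY hZ c d
  rw [hS.integral_linear_comb_mul hU hW hXY, h U hU, h W hW]
  ring

variable {b : ℕ → Ω → ℝ}

theorem integral_increment_sq (hS : IsGaussianSpace P S) (hb : ∀ j, b j ∈ S)
    (hcov : HasFBMCovariance P b) (i : ℕ) : ∫ ω, (b (i + 1) ω - b i ω) ^ 2 ∂P = 1 := by
  have h := hS.integral_linear_comb_sq (hb i) (hb (i + 1)) (-1) 1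
  have h0 := hcov i 0
  have h1 := hcov (i + 1) 0
  have h2 := hcov i 1
  simp only [add_zero, ← sq, cubeRoot_zero, cubeRoot_one] at h0 h1 h2
  rw [h0, h1, h2] at h
  rw [show (fun ω => (b (i + 1) ω - b i ω) ^ 2) = fun ω => (-1 * b i ω + 1 * b (i + 1) ω) ^ 2 by
    ext; ring, h]
  ring

set_option maxHeartbeats 1000000 in
theorem abs_integral_weighted_increments_le [IsProbabilityMeasure P] (hS : IsGaussianSpace P S)
    (hb : ∀ j, b j ∈ S) (hcov : HasFBMCovariance P b) {f : ℝ → ℝ} (hf : Measurable f)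
    (hf1 : ∀ x, |f x| ≤ 1) (i l : ℕ) (hl : 27 ≤ l) :
    |∫ ω, f (b i ω + b (i + 1) ω) * f (b (i + (l + 1)) ω + b (i + (l + 1) + 1) ω) *
        ((b (i + 1) ω - b i ω) ^ 5 * (b (i + (l + 1) + 1) ω - b (i + (l + 1)) ω) ^ 5) ∂P| ≤
      4096 * (gaussianMoment 5 + 2 * gaussianMoment 4) *
        ((cubeRoot (i + 1) ^ 4)⁻¹ + 3 * (cubeRoot (l + 1) ^ 4)⁻¹ +
          ((cubeRoot (l + 1) - cubeRoot l) - (cubeRoot (l + 1 + 1) - cubeRoot (l + 1)))) := by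
  set j := i + (l + 1) with hj
  have cj0 := hcov j 0
  have cj1 := hcov j 1
  have cj2 := hcov (j + 1) 0
  have ci0 := hcov i 0
  have ci1 := hcov i 1
  have ci2 := hcov (i + 1) 0
  have c1 := hcov i (l + 1)
  have c2 := hcov i (l + 1 + 1)
  have c3 := hcov (i + 1) l
  have c4 := hcov (i + 1) (l + 1)
  rw [show i + (l + 1 + 1) = j + 1 by omega] at c2
  rw [show i + 1 + l = j by omega] at c3
  rw [show i + 1 + (l + 1) = j + 1 by omega] at c4
  rw [← hj] at c1
  have comm : ∀ m n, ∫ ω, b m ω * b n ω ∂P = ∫ ω, b n ω * b m ω ∂P := fun m n => by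
    simp_rw [mul_comm]
  simp only [add_zero, cubeRoot_zero, cubeRoot_one] at cj0 cj1 cj2 ci0 ci1 ci2
  have bil : ∀ m n m' n' (s t s' t' : ℝ), _ := fun m n m' n' =>
    hS.integral_linear_comb_mul_linear_comb (hb m) (hb n) (hb m') (hb n')
  have hU : (fun ω => 1 * b i ω + 1 * b (i + 1) ω) ∈ S :=
    S.add_mem (S.smul_mem _ (hb _)) (S.smul_mem _ (hb _))
  have hV : (fun ω => 1 * b j ω + 1 * b (j + 1) ω) ∈ S :=
    S.add_mem (S.smul_mem _ (hb _)) (S.smul_mem _ (hb _))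
  have hX : (fun ω => -1 * b i ω + 1 * b (i + 1) ω) ∈ S :=
    S.add_mem (S.smul_mem (-1) (hb _)) (S.smul_mem _ (hb _))
  have hY : (fun ω => -1 * b j ω + 1 * b (j + 1) ω) ∈ S :=
    S.add_mem (S.smul_mem (-1) (hb _)) (S.smul_mem _ (hb _))
  set U : Ω → ℝ := fun ω => 1 * b i ω + 1 * b (i + 1) ω with hUdef
  set V : Ω → ℝ := fun ω => 1 * b j ω + 1 * b (j + 1) ω with hVdef
  set X : Ω → ℝ := fun ω => -1 * b i ω + 1 * b (i + 1) ω with hXdef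
  set Y : Ω → ℝ := fun ω => -1 * b j ω + 1 * b (j + 1) ω with hYdef
  have hW : (fun ω => 1 * V ω + -1 * U ω) ∈ S :=
    S.add_mem (S.smul_mem _ hV) (S.smul_mem (-1) hU)
  have UU := bil i (i + 1) i (i + 1) 1 1 1 1
  have UV := bil i (i + 1) j (j + 1) 1 1 1 1
  have VV := bil j (j + 1) j (j + 1) 1 1 1 1
  have XU := bil i (i + 1) i (i + 1) (-1) 1 1 1
  have XV := bil i (i + 1) j (j + 1) (-1) 1 1 1
  have YU := bil i (i + 1) j (j + 1) 1 1 (-1) 1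
  have YV := bil j (j + 1) j (j + 1) (-1) 1 1 1
  have XY := bil i (i + 1) j (j + 1) (-1) 1 (-1) 1
  rw [ci0, ci1, comm (i + 1) i, ci1, ci2] at UU XU
  rw [cj0, cj1, comm (j + 1) j, cj1, cj2] at VV YV
  rw [c1, c2, c3, c4] at UV XV YU XY
  have mul_comb : ∀ Z ∈ S, ∫ ω, Z ω * (1 * V ω + -1 * U ω) ∂P =
      ∫ ω, Z ω * V ω ∂P - ∫ ω, Z ω * U ω ∂P := fun Z hZ => by
    have := hS.integral_linear_comb_mul hV hU hZ 1 (-1)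
    simp_rw [mul_comm (Z _)]
    rw [this]
    ring
  have commf : ∀ Z Z' : Ω → ℝ, ∫ ω, Z ω * Z' ω ∂P = ∫ ω, Z' ω * Z ω ∂P := fun Z Z' => by
    simp_rw [mul_comm]
  change ∫ ω, U ω * U ω ∂P = _ at UU
  change ∫ ω, U ω * V ω ∂P = _ at UV
  change ∫ ω, V ω * V ω ∂P = _ at VV
  change ∫ ω, X ω * U ω ∂P = _ at XU
  change ∫ ω, X ω * V ω ∂P = _ at XV
  change ∫ ω, U ω * Y ω ∂P = _ at YU
  change ∫ ω, Y ω * V ω ∂P = _ at YV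
  change ∫ ω, X ω * Y ω ∂P = _ at XY
  have WW := hS.integral_linear_comb_sq hV hU 1 (-1)
  rw [commf V U] at WW
  have sqf : ∀ Z : Ω → ℝ, ∫ ω, Z ω ^ 2 ∂P = ∫ ω, Z ω * Z ω ∂P := fun Z => by simp_rw [sq]
  rw [sqf V, sqf U, UU, VV, UV] at WW
  have UW := mul_comb U hU
  have XW := mul_comb X hX
  have YW := mul_comb Y hY
  rw [UV, UU] at UW
  rw [XV, XU] at XW
  rw [commf U Y] at YU
  rw [YV, YU] at YW
  have hX1 := hS.integral_increment_sq hb hcov i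
  have hY1 := hS.integral_increment_sq hb hcov j
  have n3 := three_le_cubeRoot hl
  have ni := one_le_cubeRoot_succ i
  have ni0 := cubeRoot_nonneg i
  have mi := cubeRoot_mono (Nat.le_add_right i 1)
  have mj := cubeRoot_mono (Nat.le_add_right j 1)
  have mij : cubeRoot (i + 1) ≤ cubeRoot j := cubeRoot_mono (by omega)
  have ml := cubeRoot_mono (Nat.le_add_right l 1)
  have ml' := cubeRoot_mono (Nat.le_add_right (l + 1) 1)
  have mlj : cubeRoot (l + 1) ≤ cubeRoot j := cubeRoot_mono (by omega)
  have mlj' : cubeRoot (l + 1 + 1) ≤ cubeRoot (j + 1) := cubeRoot_mono (by omega)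
  have s1 := cubeRoot_add_le i (l + 1)
  have s2 := cubeRoot_add_le (i + 1) (l + 1)
  have s3 := cubeRoot_add_le l 1
  rw [← hj] at s1
  rw [show i + 1 + (l + 1) = j + 1 by omega] at s2
  rw [cubeRoot_one] at s3
  have di := cubeRoot_succ_sub_le i
  have dl := cubeRoot_succ_sub_le l
  have al : cubeRoot (l + 1 + 1) - cubeRoot (l + 1) ≤ cubeRoot (l + 1) - cubeRoot l :=
    cubeRoot_succ_sub_antitone (Nat.le_add_right l 1)
  have aj : cubeRoot (j + 1) - cubeRoot j ≤ cubeRoot (l + 1) - cubeRoot l :=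
    cubeRoot_succ_sub_antitone (by omega)
  have key := hS.abs_integral_weighted_pow_five_le_of_one_le hU hW hX hY
    (by rw [sqf, UU]; linarith) (by rw [WW]; linarith)
    ((integral_congr_ae (ae_of_all _ fun ω => by simp only [hXdef]; ring)).trans hX1)
    ((integral_congr_ae (ae_of_all _ fun ω => by simp only [hYdef]; ring)).trans hY1)
    (by
      rw [UW, sqf U, UU, WW]
      have h := four_mul_sq_le_mul (t := cubeRoot j + cubeRoot (j + 1) - cubeRoot i -
          cubeRoot (i + 1) - (2 * cubeRoot (l + 1) + cubeRoot (l + 1 + 1) + cubeRoot l) / 2 + 1)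
        (p := 2 * (cubeRoot (i + 1) + cubeRoot i) - 1)
        (q := 2 * cubeRoot (l + 1) + cubeRoot (l + 1 + 1) + cubeRoot l - 2)
        (by linarith) (by linarith) (by linarith) (by linarith) (by linarith)
      linarith)
    (F := fun z => f z.1 * f (z.1 + z.2)) (by fun_prop) (fun z => by
      rw [abs_mul]
      exact mul_le_one₀ (hf1 _) (abs_nonneg _) (hf1 _))
  have e : ∀ ω, f (b i ω + b (i + 1) ω) * f (b j ω + b (j + 1) ω) *
        ((b (i + 1) ω - b i ω) ^ 5 * (b (j + 1) ω - b j ω) ^ 5) =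
      f (U ω) * f (U ω + (1 * V ω + -1 * U ω)) * (X ω ^ 5 * Y ω ^ 5) := fun ω => by
    rw [show U ω + (1 * V ω + -1 * U ω) = V ω by ring]
    simp only [hUdef, hVdef, hXdef, hYdef]
    ring_nf
  simp_rw [e]
  refine key.trans (mul_le_mul_of_nonneg_left ?_ ?_)
  · have q1 : (∫ ω, X ω * U ω ∂P) ^ 2 ≤ ((cubeRoot (i + 1) ^ 2)⁻¹) ^ 2 := by
      rw [XU]
      refine sq_le_sq' ?_ ?_
      · linarith [inv_nonneg.2 (sq_nonneg (cubeRoot (i + 1)))]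
      · linarith
    have q2 : (∫ ω, X ω * (1 * V ω + -1 * U ω) ∂P) ^ 2 ≤ ((cubeRoot (l + 1) ^ 2)⁻¹) ^ 2 := by
      rw [XW]
      exact sq_le_sq' (by linarith) (by linarith)
    have q3 : (∫ ω, Y ω * U ω ∂P) ^ 2 ≤ ((cubeRoot (l + 1) ^ 2)⁻¹) ^ 2 := by
      rw [YU]
      exact sq_le_sq' (by linarith) (by linarith)
    have q4 : (∫ ω, Y ω * (1 * V ω + -1 * U ω) ∂P) ^ 2 ≤ ((cubeRoot (l + 1) ^ 2)⁻¹) ^ 2 := by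
      rw [YW]
      exact sq_le_sq' (by linarith) (by linarith)
    have q5 : |∫ ω, X ω * Y ω ∂P| ≤
        (cubeRoot (l + 1) - cubeRoot l) - (cubeRoot (l + 1 + 1) - cubeRoot (l + 1)) := by
      rw [XY, abs_le]
      constructor <;> linarith
    rw [inv_pow, ← pow_mul] at q1 q2 q3 q4
    linarith
  · have g4 := gaussianMoment_nonneg 4
    have g5 := gaussianMoment_nonneg 5
    positivity

end IsGaussianSpace

theorem sum_comp_le_tsum_of_injOn {ι : Type*} {g : ℕ → ℝ} (hg : Summable g) (g0 : ∀ k, 0 ≤ g k)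
    {s : Finset ι} {e : ι → ℕ} (he : Set.InjOn e s) : ∑ j ∈ s, g (e j) ≤ ∑' k, g k := by
  classical
  rw [← Finset.sum_image (f := g) he]
  exact hg.sum_le_tsum _ fun k _ => g0 k

theorem sum_sum_le_of_le_add {a : ℕ → ℕ → ℝ} {h g : ℕ → ℝ} (hh : Summable h) (hg : Summable g)
    (h0 : ∀ i, 0 ≤ h i) (g0 : ∀ k, 0 ≤ g k) (hsymm : ∀ i j, a i j = a j i)
    (ha : ∀ i k, a i (i + k) ≤ h i + g k) (N : ℕ) :
    ∑ i ∈ Finset.range N, ∑ j ∈ Finset.range N, a i j ≤ 2 * (∑' i, h i + ∑' k, g k) * N := by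
  have hle : ∀ i j, a i j ≤ h i + h j + g (i - j + (j - i)) := fun i j => by
    rcases le_total i j with hij | hij
    · have := ha i (j - i)
      rw [Nat.add_sub_cancel' hij] at this
      rw [Nat.sub_eq_zero_of_le hij, zero_add]
      linarith [h0 j]
    · have := ha j (i - j)
      rw [Nat.add_sub_cancel' hij] at this
      rw [hsymm, Nat.sub_eq_zero_of_le hij, add_zero]
      linarith [h0 i]
  have hg2 : ∀ i, ∑ j ∈ Finset.range N, g (i - j + (j - i)) ≤ 2 * ∑' k, g k := fun i => by
    rw [← Finset.sum_filter_add_sum_filter_not _ (fun j => j ≤ i), two_mul]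
    refine add_le_add (sum_comp_le_tsum_of_injOn hg g0 ?_) (sum_comp_le_tsum_of_injOn hg g0 ?_)
    · intro x hx y hy hxy
      simp at hx hy hxy
      omega
    · intro x hx y hy hxy
      simp at hx hy hxy
      omega
  have hh1 : ∑ i ∈ Finset.range N, h i ≤ ∑' i, h i := hh.sum_le_tsum _ fun i _ => h0 i
  calc ∑ i ∈ Finset.range N, ∑ j ∈ Finset.range N, a i j
      ≤ ∑ i ∈ Finset.range N, ∑ j ∈ Finset.range N, (h i + h j + g (i - j + (j - i))) := by
        gcongr with i _ j _
        exact hle i j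
    _ = ∑ i ∈ Finset.range N, (N * h i + ∑ j ∈ Finset.range N, h j +
          ∑ j ∈ Finset.range N, g (i - j + (j - i))) := by
        simp [Finset.sum_add_distrib]
    _ ≤ ∑ i ∈ Finset.range N, (N * h i + ∑' j, h j + 2 * ∑' k, g k) := by
        gcongr with i _
        exact hg2 i
    _ = N * (∑ i ∈ Finset.range N, h i) + N * (∑' j, h j + 2 * ∑' k, g k) := by
        simp only [Finset.sum_add_distrib, ← Finset.mul_sum, Finset.sum_const, Finset.card_range,
          nsmul_eq_mul]
        ring
    _ ≤ N * (∑' j, h j) + N * (∑' j, h j + 2 * ∑' k, g k) := by gcongr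
    _ = _ := by ring

namespace IsGaussianSpace

theorem exists_integral_sum_sq_le {Ω : Type*} [MeasurableSpace Ω] (P : Measure Ω)
    [IsProbabilityMeasure P] :
    ∃ C : ℝ, 0 ≤ C ∧ ∀ S : Submodule ℝ (Ω → ℝ), IsGaussianSpace P S →
      ∀ b : ℕ → Ω → ℝ, (∀ j, b j ∈ S) → HasFBMCovariance P b →
      ∀ f : ℝ → ℝ, Measurable f → (∀ x, |f x| ≤ 1) → ∀ N : ℕ,
        MemLp (fun ω => ∑ i ∈ Finset.range N,
          f (b i ω + b (i + 1) ω) * (b (i + 1) ω - b i ω) ^ 5) 2 P ∧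
        ∫ ω, (∑ i ∈ Finset.range N,
          f (b i ω + b (i + 1) ω) * (b (i + 1) ω - b i ω) ^ 5) ^ 2 ∂P ≤ C * N := by
  set K := 4096 * (gaussianMoment 5 + 2 * gaussianMoment 4) with hKdef
  have g4 := gaussianMoment_nonneg 4
  have g5 := gaussianMoment_nonneg 5
  have hK : 0 ≤ K := by positivity
  let h : ℕ → ℝ := fun i => K * (cubeRoot (i + 1) ^ 4)⁻¹
  let g₁ : ℕ → ℝ := fun l => K * (3 * (cubeRoot (l + 1) ^ 4)⁻¹ +
    ((cubeRoot (l + 1) - cubeRoot l) - (cubeRoot (l + 1 + 1) - cubeRoot (l + 1))))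
  let g₂ : ℕ → ℝ := fun l => if l < 27 then gaussianMoment 5 else 0
  let g : ℕ → ℝ := fun k => k.casesOn (gaussianMoment 5) fun l => g₁ l + g₂ l
  have g₁0 : ∀ l, 0 ≤ g₁ l := fun l => by
    have : cubeRoot (l + 1 + 1) - cubeRoot (l + 1) ≤ cubeRoot (l + 1) - cubeRoot l :=
      cubeRoot_succ_sub_antitone (Nat.le_add_right l 1)
    have h1 := one_le_cubeRoot_succ l
    exact mul_nonneg hK (add_nonneg (by positivity) (sub_nonneg.2 this))
  have g₂0 : ∀ l, 0 ≤ g₂ l := fun l => by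
    simp only [g₂]
    split_ifs <;> simp [g5]
  have g0 : ∀ k, 0 ≤ g k := fun k => by
    cases k with
    | zero => exact g5
    | succ l => exact add_nonneg (g₁0 l) (g₂0 l)
  have h0 : ∀ i, 0 ≤ h i := fun i => by
    have := one_le_cubeRoot_succ i
    positivity
  have hh : Summable h := summable_inv_cubeRoot_pow_four.mul_left K
  have hg₁ : Summable g₁ := ((summable_inv_cubeRoot_pow_four.mul_left 3).add
    summable_cubeRoot_second_difference).mul_left K
  have hg₂ : Summable g₂ := summable_of_ne_finset_zero (s := Finset.range 27) fun l hl => by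
    simp only [Finset.mem_range] at hl
    simp [g₂, hl]
  have hg : Summable g := (summable_nat_add_iff 1).1 (hg₁.add hg₂)
  refine ⟨2 * (∑' i, h i + ∑' k, g k), mul_nonneg zero_le_two
    (add_nonneg (tsum_nonneg h0) (tsum_nonneg g0)), fun S hS b hb hcov f hf hf1 N => ?_⟩
  have hX : ∀ i, (fun ω => b (i + 1) ω - b i ω) ∈ S := fun i => S.sub_mem (hb _) (hb _)
  have hX1 := hS.integral_increment_sq hb hcov
  have mb : ∀ i, Measurable (b i) := fun i => (hS _ (hb i)).1
  have hw : ∀ i j ω, |f (b i ω + b (i + 1) ω) * f (b j ω + b (j + 1) ω)| ≤ 1 := fun i j ω => by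
    rw [abs_mul]
    exact mul_le_one₀ (hf1 _) (abs_nonneg _) (hf1 _)
  let e : ℕ → ℕ → Ω → ℝ := fun i j ω => f (b i ω + b (i + 1) ω) * f (b j ω + b (j + 1) ω) *
    ((b (i + 1) ω - b i ω) ^ 5 * (b (j + 1) ω - b j ω) ^ 5)
  have he : ∀ i j, Integrable (e i j) P := fun i j =>
    hS.integrable_mul_pow_five (hX i) (hX j) (by fun_prop) (hw i j)
  have hsq : ∀ ω, (∑ i ∈ Finset.range N,
      f (b i ω + b (i + 1) ω) * (b (i + 1) ω - b i ω) ^ 5) ^ 2 =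
      ∑ i ∈ Finset.range N, ∑ j ∈ Finset.range N, e i j ω := fun ω => by
    rw [sq, Finset.sum_mul_sum]
    refine Finset.sum_congr rfl fun i _ => Finset.sum_congr rfl fun j _ => ?_
    simp only [e]
    ring
  have hint : Integrable (fun ω => ∑ i ∈ Finset.range N, ∑ j ∈ Finset.range N, e i j ω) P :=
    integrable_finsetSum _ fun i _ => integrable_finsetSum _ fun j _ => he i j
  refine ⟨(memLp_two_iff_integrable_sq (by fun_prop)).2 (by simpa only [hsq] using hint), ?_⟩
  simp_rw [hsq]
  rw [integral_finsetSum _ fun i _ => integrable_finsetSum _ fun j _ => he i j]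
  simp_rw [integral_finsetSum (Finset.range N) fun j _ => he _ j]
  refine sum_sum_le_of_le_add hh hg h0 g0 (fun i j => ?_) (fun i k => (le_abs_self _).trans ?_) N
  · refine integral_congr_ae (ae_of_all _ fun ω => ?_)
    simp only [e]
    ring
  · have htriv : |∫ ω, e i (i + k) ω ∂P| ≤ gaussianMoment 5 :=
      hS.abs_integral_mul_pow_five_le (hX i) (hX (i + k)) (hX1 _) (hX1 _) (hw _ _)
    cases k with
    | zero => linarith [h0 i, show g 0 = gaussianMoment 5 from rfl]
    | succ l =>
      have hgl : g (l + 1) = g₁ l + g₂ l := rfl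
      by_cases hl : l < 27
      · have : g₂ l = gaussianMoment 5 := if_pos hl
        linarith [h0 i, g₁0 l]
      · have h1 := hS.abs_integral_weighted_increments_le hb hcov hf hf1 i l (by omega)
        refine h1.trans ?_
        rw [hgl]
        simp only [h, g₁]
        linarith [g₂0 l]

end IsGaussianSpace

namespace IsGaussianSpace

variable {Ω : Type*} [MeasurableSpace Ω] {P : Measure Ω} {S : Submodule ℝ (Ω → ℝ)}

theorem measureReal_le_mul_abs_pow_five_le [IsProbabilityMeasure P] (hS : IsGaussianSpace P S)
    {X : Ω → ℝ} (hX : X ∈ S) (hX1 : ∫ ω, X ω ^ 2 ∂P = 1) (r : ℝ) {s : ℝ} (hs : 0 < s) :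
    P.real {ω | s ≤ r * |X ω| ^ 5} ≤ gaussianMoment 10 * r ^ 4 / s ^ 4 := by
  have hsub : {ω | s ≤ r * |X ω| ^ 5} ⊆ {ω | s ^ 4 ≤ r ^ 4 * X ω ^ (2 * 10)} := 
      fun ω (hω : s ≤ r * |X ω| ^ 5) => by
    have h := pow_le_pow_left₀ hs.le hω 4
    rw [mul_pow, ← pow_mul, Even.pow_abs (by decide)] at h
    exact h
  have h := mul_meas_ge_le_integral_of_nonneg (μ := P) (f := fun ω => r ^ 4 * X ω ^ (2 * 10))
    (ae_of_all _ fun ω => mul_nonneg (by positivity) (Even.pow_nonneg (by decide) _))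
    ((hS.integrable_even_pow hX 10).const_mul _) (s ^ 4)
  rw [integral_const_mul, hS.integral_even_pow hX, hX1, one_pow, one_mul] at h
  rw [le_div_iff₀ (by positivity)]
  calc _ ≤ P.real {ω | s ^ 4 ≤ r ^ 4 * X ω ^ (2 * 10)} * s ^ 4 := by
        exact mul_le_mul_of_nonneg_right (measureReal_mono hsub) (by positivity)
    _ ≤ _ := by linarith

end IsGaussianSpace

theorem abs_sum_range_lt_of_block_lt {x : ℕ → ℝ} {N m : ℕ} (hm : 0 < m) {s : ℝ}
    (hblock : ∀ l ≤ N / m, |∑ i ∈ Finset.range (m * l), x i| < s)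
    (hincr : ∀ i < N, m * |x i| < s) {k : ℕ} (hk : k ≤ N) :
    |∑ i ∈ Finset.range k, x i| < 2 * s := by
  have h1 := hblock (k / m) (Nat.div_le_div_right hk)
  have hle : m * (k / m) ≤ k := Nat.mul_div_le k m
  have hs : 0 < s := (abs_nonneg _).trans_lt h1
  have hm' : (0 : ℝ) < m := by exact_mod_cast hm
  rw [← Finset.sum_range_add_sum_Ico _ hle]
  have h2 : |∑ i ∈ Finset.Ico (m * (k / m)) k, x i| ≤ s := by
    refine (Finset.abs_sum_le_sum_abs _ _).trans ?_
    have : ∑ i ∈ Finset.Ico (m * (k / m)) k, |x i| ≤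
        ∑ i ∈ Finset.Ico (m * (k / m)) k, s / m := Finset.sum_le_sum fun i hi => by
      rw [le_div_iff₀ hm', mul_comm]
      exact (hincr i ((Finset.mem_Ico.1 hi).2.trans_le hk)).le
    refine this.trans ?_
    rw [Finset.sum_const, Nat.card_Ico, nsmul_eq_mul, mul_div_assoc', div_le_iff₀ hm', mul_comm]
    gcongr
    have := Nat.div_add_mod k m
    have := Nat.mod_lt k hm
    omega
  linarith [abs_add_le (∑ i ∈ Finset.range (m * (k / m)), x i)
    (∑ i ∈ Finset.Ico (m * (k / m)) k, x i)]

theorem measureReal_exists_abs_sum_range_le {Ω : Type*} [MeasurableSpace Ω] {P : Measure Ω}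
    [IsProbabilityMeasure P] {x : ℕ → Ω → ℝ} {C D s : ℝ} {N m : ℕ} (hC : 0 ≤ C) (hm : 0 < m)
    (hs : 0 < s)
    (hL2 : ∀ k, MemLp (fun ω => ∑ i ∈ Finset.range k, x i ω) 2 P)
    (hsq : ∀ k, ∫ ω, (∑ i ∈ Finset.range k, x i ω) ^ 2 ∂P ≤ C * k)
    (hx : ∀ i, P.real {ω | s ≤ m * |x i ω|} ≤ D) :
    P.real {ω | ∃ k ≤ N, 2 * s ≤ |∑ i ∈ Finset.range k, x i ω|} ≤
      ((N : ℝ) / m + 1) * (C * N / s ^ 2) + N * D := by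
  have hsub : {ω | ∃ k ≤ N, 2 * s ≤ |∑ i ∈ Finset.range k, x i ω|} ⊆
      (⋃ l ∈ Finset.range (N / m + 1), {ω | s ≤ |∑ i ∈ Finset.range (m * l), x i ω|}) ∪
        ⋃ i ∈ Finset.range N, {ω | s ≤ m * |x i ω|} := by
    rintro ω ⟨k, hk, hle⟩
    by_contra hω
    simp only [Set.mem_union, Set.mem_iUnion, Set.mem_ofPred_eq, Finset.mem_range, exists_prop,
      not_or, not_exists, not_and, not_le, Nat.lt_succ_iff] at hω
    exact hle.not_gt (abs_sum_range_lt_of_block_lt hm hω.1 hω.2 hk)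
  have hblock : ∀ l ∈ Finset.range (N / m + 1),
      P.real {ω | s ≤ |∑ i ∈ Finset.range (m * l), x i ω|} ≤ C * N / s ^ 2 := fun l hl => by
    have h := mul_meas_ge_le_integral_of_nonneg (μ := P)
      (f := fun ω => (∑ i ∈ Finset.range (m * l), x i ω) ^ 2)
      (ae_of_all _ fun ω => sq_nonneg _) (hL2 _).integrable_sq (s ^ 2)
    rw [le_div_iff₀ (by positivity)]
    have hmN : ((m * l : ℕ) : ℝ) ≤ N := by
      have h1 : l ≤ N / m := Nat.lt_succ_iff.1 (Finset.mem_range.1 hl)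
      exact_mod_cast (Nat.mul_le_mul_left m h1).trans (Nat.mul_div_le N m)
    calc _ ≤ P.real {ω | s ^ 2 ≤ (∑ i ∈ Finset.range (m * l), x i ω) ^ 2} * s ^ 2 := by
          refine mul_le_mul_of_nonneg_right (measureReal_mono
            fun ω (hω : s ≤ |∑ i ∈ Finset.range (m * l), x i ω|) => ?_) (by positivity)
          have h := pow_le_pow_left₀ hs.le hω 2
          rwa [sq_abs] at h
      _ ≤ C * (m * l : ℕ) := by linarith [hsq (m * l)]
      _ ≤ C * N := by gcongr
  calc _ ≤ _ := measureReal_mono hsub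
    _ ≤ _ := measureReal_union_le _ _
    _ ≤ _ := add_le_add (measureReal_biUnion_finset_le _ _) (measureReal_biUnion_finset_le _ _)
    _ ≤ ∑ l ∈ Finset.range (N / m + 1), C * N / s ^ 2 + ∑ i ∈ Finset.range N, D :=
        add_le_add (Finset.sum_le_sum hblock) (Finset.sum_le_sum fun i _ => hx i)
    _ = ((N / m : ℕ) + 1) * (C * N / s ^ 2) + N * D := by simp
    _ ≤ _ := by
        gcongr
        exact Nat.cast_div_le

namespace IsFBM16

variable {Ω : Type*} [MeasureSpace Ω] {B : ℝ → Ω → ℝ}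

theorem isGaussianSpace (hB : IsFBM16 B) :
    IsGaussianSpace (volume : Measure Ω) (Submodule.span ℝ (B '' Set.Ici 0)) := by
  intro Z hZ
  obtain ⟨m, c, g, rfl⟩ := Submodule.mem_span_set'.1 hZ
  choose t ht htg using fun i => (g i).2
  obtain ⟨v, hv⟩ := hB.2.2.1 m t c ht
  have e : ∑ i, c i • (g i : Ω → ℝ) = fun ω => ∑ i, c i * B (t i) ω := by
    ext ω
    simp [← htg]
  have mB := hB.1
  rw [e]
  exact ⟨by fun_prop, v, hv⟩

theorem hasFBMCovariance (hB : IsFBM16 B) {n : ℕ} (hn : n ≠ 0) {y : ℝ}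
    (hy : y ^ 2 = (n : ℝ) ^ ((1 : ℝ) / 3)) :
    HasFBMCovariance (volume : Measure Ω) fun j ω => y * B ((j : ℝ) / n) ω := by
  intro i k
  have hn' : (0 : ℝ) < n := by positivity
  have h := hB.2.2.2 ((i : ℝ) / n) (((i + k : ℕ) : ℝ) / n) (by positivity) (by positivity)
  have e : |((i + k : ℕ) : ℝ) / n - (i : ℝ) / n| = (k : ℝ) / n := by
    push_cast
    rw [← sub_div, add_sub_cancel_left, abs_of_nonneg (by positivity)]
  have hc : ∀ j : ℕ, y ^ 2 * ((j : ℝ) / n) ^ ((1 : ℝ) / 3) = cubeRoot j := fun j => by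
    rw [hy, ← Real.mul_rpow (by positivity) (by positivity), mul_div_cancel₀ _ hn'.ne', cubeRoot]
  have e2 : ∀ ω, y * B ((i : ℝ) / n) ω * (y * B (((i + k : ℕ) : ℝ) / n) ω) =
      y ^ 2 * (B ((i : ℝ) / n) ω * B (((i + k : ℕ) : ℝ) / n) ω) := fun ω => by ring
  simp_rw [e2]
  rw [integral_const_mul, h, e, ← hc i, ← hc (i + k), ← hc k]
  ring

/-- A quantitative maximal inequality for the weighted fifth-power variation. -/
theorem exists_measureReal_le [IsProbabilityMeasure (volume : Measure Ω)] (hB : IsFBM16 B)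
    {φ : ℝ → ℝ} (hφ : Measurable φ) {M : ℝ} (hM : 0 < M) (hφM : ∀ x, |φ x| ≤ M) {T ε : ℝ}
    (hT : 0 < T) (hε : 0 < ε) :
    ∃ K₁ K₂ : ℝ, ∀ n : ℕ, n ≠ 0 → ∀ y : ℝ, 0 < y → y ^ 6 = n →
      (volume : Measure Ω).real {ω | ∃ k ≤ ⌊(n : ℝ) * T⌋₊, ε ≤ |∑ i ∈ Finset.range k,
        φ ((B ((i : ℝ) / n) ω + B (((i + 1 : ℕ) : ℝ) / n) ω) / 2) *
          (B (((i + 1 : ℕ) : ℝ) / n) ω - B ((i : ℝ) / n) ω) ^ 5|} ≤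
        K₁ * (T * y⁻¹ + y⁻¹ ^ 4) + K₂ * y⁻¹ ^ 2 := by
  obtain ⟨C, hC, hmom⟩ := IsGaussianSpace.exists_integral_sum_sq_le (volume : Measure Ω)
  have g10 := gaussianMoment_nonneg 10
  refine ⟨C * T * (2 * M) ^ 2 / ε ^ 2, T * gaussianMoment 10 * 2 ^ 4 * (2 * M) ^ 4 / ε ^ 4,
    fun n hn y hy hyn => ?_⟩
  have hn' : (0 : ℝ) < n := by positivity
  have hy2 : y ^ 2 = (n : ℝ) ^ ((1 : ℝ) / 3) := by
    rw [← hyn, ← Real.rpow_natCast, ← Real.rpow_natCast, ← Real.rpow_mul hy.le]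
    norm_num
  set b : ℕ → Ω → ℝ := fun j ω => y * B ((j : ℝ) / n) ω with hbdef
  set S := Submodule.span ℝ (B '' Set.Ici 0)
  have hS := hB.isGaussianSpace
  have hb : ∀ j, b j ∈ S := fun j => S.smul_mem y (Submodule.subset_span ⟨_, by
    simp only [Set.mem_Ici]; positivity, rfl⟩)
  have hcov : HasFBMCovariance volume b := hB.hasFBMCovariance hn hy2
  set f : ℝ → ℝ := fun x => φ (x / (2 * y)) / M with hfdef
  have hf : Measurable f := by fun_prop
  have hf1 : ∀ x, |f x| ≤ 1 := fun x => by
    rw [hfdef, abs_div, abs_of_pos hM]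
    exact (div_le_one hM).2 (hφM _)
  set m := Nat.sqrt n + 1 with hm
  have hmy : y ^ 3 ≤ m := by
    have h : (n : ℝ) < (m : ℝ) * m := by exact_mod_cast Nat.lt_succ_sqrt n
    rw [← hyn] at h
    refine le_of_sq_le_sq ?_ (by positivity)
    nlinarith
  have hmy' : (m : ℝ) ≤ 2 * y ^ 3 := by
    have h1 : (Nat.sqrt n : ℝ) * Nat.sqrt n ≤ n := by exact_mod_cast Nat.sqrt_le n
    have h2 : (1 : ℝ) ≤ Nat.sqrt n := by
      exact_mod_cast Nat.sqrt_pos.2 (Nat.pos_of_ne_zero hn)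
    have h3 : (Nat.sqrt n : ℝ) ≤ y ^ 3 := by
      refine le_of_sq_le_sq ?_ (by positivity)
      nlinarith
    rw [hm]
    push_cast
    linarith
  set s := ε * y ^ 5 / (2 * M) with hsdef
  have hs : 0 < s := by positivity
  have key := measureReal_exists_abs_sum_range_le (P := volume)
    (x := fun i ω => f (b i ω + b (i + 1) ω) * (b (i + 1) ω - b i ω) ^ 5)
    (N := ⌊(n : ℝ) * T⌋₊) (m := m) hC (Nat.succ_pos _) hs
    (fun k => (hmom S hS b hb hcov f hf hf1 k).1) (fun k => (hmom S hS b hb hcov f hf hf1 k).2)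
    (D := gaussianMoment 10 * (m : ℝ) ^ 4 / s ^ 4) (fun i => by
      refine (measureReal_mono fun ω hω => ?_).trans
        (hS.measureReal_le_mul_abs_pow_five_le (S.sub_mem (hb (i + 1)) (hb i))
          (hS.integral_increment_sq hb hcov i) m hs)
      refine (show s ≤ _ from hω).trans ?_
      rw [abs_mul, abs_pow]
      exact mul_le_mul_of_nonneg_left (mul_le_of_le_one_left (by positivity) (hf1 _))
        (by positivity))
  have hN : (⌊(n : ℝ) * T⌋₊ : ℝ) ≤ y ^ 6 * T := by
    rw [hyn]
    exact Nat.floor_le (by positivity)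
  have hset : ∀ k ω, |∑ i ∈ Finset.range k,
        φ ((B ((i : ℝ) / n) ω + B (((i + 1 : ℕ) : ℝ) / n) ω) / 2) *
          (B (((i + 1 : ℕ) : ℝ) / n) ω - B ((i : ℝ) / n) ω) ^ 5| =
      M / y ^ 5 * |∑ i ∈ Finset.range k,
        f (b i ω + b (i + 1) ω) * (b (i + 1) ω - b i ω) ^ 5| := fun k ω => by
    conv_rhs => rw [← abs_of_pos (show 0 < M / y ^ 5 by positivity), ← abs_mul, Finset.mul_sum]
    congr 1
    refine Finset.sum_congr rfl fun i _ => ?_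
    have e1 : (b i ω + b (i + 1) ω) / (2 * y) =
        (B ((i : ℝ) / n) ω + B (((i + 1 : ℕ) : ℝ) / n) ω) / 2 := by
      simp only [hbdef]
      field_simp
    have e2 : b (i + 1) ω - b i ω = y * (B (((i + 1 : ℕ) : ℝ) / n) ω - B ((i : ℝ) / n) ω) := by
      simp only [hbdef]
      ring
    simp only [hfdef]
    rw [e1, e2]
    field_simp
  have hev : ∀ a : ℝ, ε ≤ M / y ^ 5 * a ↔ 2 * s ≤ a := fun a => by
    rw [show 2 * s = ε / (M / y ^ 5) by rw [hsdef]; field_simp, div_le_iff₀' (by positivity)]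
  simp only [hset, hev]
  refine key.trans (add_le_add ?_ ?_)
  · calc _ ≤ (y ^ 6 * T / y ^ 3 + 1) * (C * (y ^ 6 * T) / s ^ 2) := by gcongr
      _ = _ := by
        rw [hsdef]
        field_simp
  · calc _ ≤ y ^ 6 * T * (gaussianMoment 10 * (2 * y ^ 3) ^ 4 / s ^ 4) := by gcongr
      _ = _ := by
        rw [hsdef]
        field_simp

end IsFBM16

theorem sum_Icc_one_eq_sum_range {α : Type*} [AddCommMonoid α] (g : ℕ → α) (k : ℕ) :
    ∑ j ∈ Finset.Icc 1 k, g j = ∑ i ∈ Finset.range k, g (i + 1) := by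
  induction k with
  | zero => simp
  | succ k ih => rw [Finset.sum_Icc_succ_top (by omega), Finset.sum_range_succ, ih]

/-- For `φ ∈ C¹` with compact support,
`sup_{0 ≤ t ≤ T} |∑_{j=1}^{⌊nt⌋} φ(β_{j,n}) (ΔB_{j,n})⁵| → 0` in probability. -/
theorem stmt7 {Ω : Type*} [MeasureSpace Ω] [IsProbabilityMeasure (volume : Measure Ω)]
    (B : ℝ → Ω → ℝ) (hB : IsFBM16 B) (φ : ℝ → ℝ)
    (hφ : ContDiff ℝ 1 φ) (hsupp : HasCompactSupport φ) :
    ∀ T > (0 : ℝ), ∀ ε > (0 : ℝ),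
      Tendsto (fun n : ℕ =>
          volume {ω : Ω | ε ≤
            ⨆ t ∈ Set.Icc (0 : ℝ) T,
              |∑ j ∈ Finset.Icc 1 ⌊(n : ℝ) * t⌋₊,
                φ ((B (((j : ℝ) - 1) / n) ω + B ((j : ℝ) / n) ω) / 2) *
                  (B ((j : ℝ) / n) ω - B (((j : ℝ) - 1) / n) ω) ^ 5|})
        atTop (𝓝 0) := by
  intro T hT ε hε
  obtain ⟨M₀, hM₀⟩ := hsupp.exists_bound_of_continuous hφ.continuous
  obtain ⟨K₁, K₂, hK⟩ := hB.exists_measureReal_le hφ.continuous.measurable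
    (M := max M₀ 1) (by positivity) (fun x => (hM₀ x).trans (le_max_left _ _)) hT (half_pos hε)
  have hy : Tendsto (fun n : ℕ => ((n : ℝ) ^ ((1 : ℝ) / 6))⁻¹) atTop (𝓝 0) :=
    ((tendsto_rpow_atTop (by norm_num)).comp tendsto_natCast_atTop_atTop).inv_tendsto_atTop
  have hlim : Tendsto (fun n : ℕ => ENNReal.ofReal
      (K₁ * (T * ((n : ℝ) ^ ((1 : ℝ) / 6))⁻¹ + ((n : ℝ) ^ ((1 : ℝ) / 6))⁻¹ ^ 4) +
        K₂ * ((n : ℝ) ^ ((1 : ℝ) / 6))⁻¹ ^ 2)) atTop (𝓝 0) := by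
    have h := (((hy.const_mul T).add (hy.pow 4)).const_mul K₁).add ((hy.pow 2).const_mul K₂)
    simpa using ENNReal.tendsto_ofReal h
  refine tendsto_of_tendsto_of_tendsto_of_le_of_le' tendsto_const_nhds hlim
    (Eventually.of_forall fun _ => zero_le) ?_
  filter_upwards [eventually_ne_atTop 0] with n hn
  have hn' : (0 : ℝ) < n := by positivity
  have key := hK n hn ((n : ℝ) ^ ((1 : ℝ) / 6)) (by positivity) (by
    rw [← Real.rpow_natCast, ← Real.rpow_mul (by positivity)]
    norm_num)
  refine le_trans (measure_mono fun ω (hω : ε ≤ _) => ?_)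
    ((ofReal_measureReal (μ := volume)).symm.le.trans (ENNReal.ofReal_le_ofReal key))
  by_contra hlt
  simp only [Set.mem_ofPred_eq, not_exists, not_and, not_le] at hlt
  refine hω.not_gt (lt_of_le_of_lt ?_ (half_lt_self hε))
  refine Real.iSup_le (fun t => Real.iSup_le (fun ht => ?_) (half_pos hε).le) (half_pos hε).le
  rw [sum_Icc_one_eq_sum_range]
  have := hlt ⌊(n : ℝ) * t⌋₊ (Nat.floor_le_floor (by gcongr; exact ht.2))
  simpa using this.le
end
end
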